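/- Let k be a field of characteristic p > 0 that admits infinitely many pairwise inequivalent discrete valuations. Let L/k be a finite Galois extension with group G = Gal(L/k), let Γ be a finite group, and let f : Γ → G be a surjective homomorphism whose kernel is a p-group. Let S be a finite set of pairwise inequivalent discrete valuations of k such that each v ∈ S has a unique extension to L (equivalently, L ⊗_k k_v is a field). Then there exists a finite Galois extension K of k containing L and an isomorphism ψ : Gal(K/k) → Γ with f(ψ(σ)) equal to the restriction of σ to L for all σ ∈ Gal(K/k), and such that each v ∈ S has a unique extension to K (equivalently, K ⊗_k k_v is a field). -/

import Mathlib

/-- An absolute value (rank-1 valuation) is nonarchimedean if it satisfies the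
ultrametric inequality. -/
def AbsoluteValue.IsNonarch {k : Type} [Field k] (v : AbsoluteValue k ℝ) : Prop :=
  ∀ x y : k, v (x + y) ≤ max (v x) (v y)

/-- Two absolute values on `k` are equivalent (induce the same topology) iff one is a
positive real power of the other. -/
def AbsoluteValue.IsEquivalent {k : Type} [Field k] (v w : AbsoluteValue k ℝ) : Prop :=
  ∃ r : ℝ, 0 < r ∧ ∀ x : k, w x = v x ^ r

/-- A discrete valuation on `k`, encoded as a nonarchimedean absolute value which is
nontrivial and whose value group `v(kˣ)` is the infinite cyclic group `cᶻ` generated by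
some real number `0 < c < 1` (so the value group is isomorphic to `ℤ`). -/
def AbsoluteValue.IsDiscrete {k : Type} [Field k] (v : AbsoluteValue k ℝ) : Prop :=
  v.IsNonarch ∧ ∃ c : ℝ, 0 < c ∧ c < 1 ∧ (∃ x : k, v x = c) ∧
    ∀ x : k, x ≠ 0 → ∃ n : ℤ, v x = c ^ n

section AbsoluteValues

/-- In positive characteristic every real absolute value is nonarchimedean. -/
theorem AbsoluteValue.isNonarchimedean_of_charP (p : ℕ) [Fact p.Prime] {F : Type*} [Field F]
    [CharP F p] (w : AbsoluteValue F ℝ) : IsNonarchimedean w := by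
  have key : ∀ n : ℕ, w (n : F) ≤ 1 := by
    intro n
    by_cases hn : (n : F) = 0
    · simp [hn]
    · have h1 : ((n : ZMod p) : ZMod p) ≠ 0 := by
        intro h
        apply hn
        rwa [CharP.cast_eq_zero_iff F p, ← CharP.cast_eq_zero_iff (ZMod p) p]
      have h2 : (n : F) ^ (p - 1) = 1 := by
        have := congrArg (ZMod.castHom (dvd_refl p) F) (ZMod.pow_card_sub_one_eq_one h1)
        simpa using this
      have h3 : w (n : F) ^ (p - 1) = 1 := by rw [← map_pow, h2, map_one]
      have hp : p - 1 ≠ 0 := by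
        have := (Fact.out : p.Prime).two_le
        omega
      exact ((pow_eq_one_iff_of_nonneg (w.nonneg _) hp).1 h3).le
  have : IsUltrametricDist (WithAbs w) :=
    IsUltrametricDist.isUltrametricDist_of_forall_norm_natCast_le_one fun n => by
      rw [WithAbs.norm_eq_apply_ofAbs, show (n : WithAbs w).ofAbs = (n : F) from
        map_natCast (WithAbs.equiv w) n]
      exact key n
  intro x y
  exact IsUltrametricDist.norm_add_le_max (WithAbs.toAbs w x) (WithAbs.toAbs w y)

theorem IsNonarchimedean.apply_sum_lt {F ι : Type*} [Field F] {w : AbsoluteValue F ℝ}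
    (hw : IsNonarchimedean w) {s : Finset ι} {g : ι → F} {C : ℝ} (hC : 0 < C)
    (h : ∀ i ∈ s, w (g i) < C) : w (∑ i ∈ s, g i) < C := by
  classical
  induction s using Finset.induction_on with
  | empty => simpa using hC
  | insert a s ha ih =>
    rw [Finset.sum_insert ha]
    exact (hw _ _).trans_lt (max_lt (h a (Finset.mem_insert_self a s))
      (ih fun i hi => h i (Finset.mem_insert_of_mem hi)))

theorem IsNonarchimedean.apply_sub_lt {F : Type*} [Field F] {w : AbsoluteValue F ℝ}
    (hw : IsNonarchimedean w) {x y : F} {C : ℝ} (hx : w x < C) (hy : w y < C) :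
    w (x - y) < C := by
  rw [sub_eq_add_neg]
  exact (hw _ _).trans_lt (max_lt hx (by rwa [w.map_neg]))

/-- Weak approximation, for an arbitrary target vector. -/
theorem AbsoluteValue.exists_forall_apply_sub_lt {F ι : Type*} [Field F] [Finite ι]
    {v : ι → AbsoluteValue F ℝ} (h : ∀ i, (v i).IsNontrivial)
    (hv : Pairwise fun i j => ¬ (v i).IsEquiv (v j)) (z : ι → F) {r : ℝ} (hr : 0 < r) :
    ∃ y : F, ∀ i, v i (y - z i) < r := by
  have := Fintype.ofFinite ι
  obtain ⟨y, hy⟩ := Metric.denseRange_iff.1 (denseRange_algebraMap_pi h hv)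
    (fun i => WithAbs.toAbs (v i) (z i)) r hr
  refine ⟨y, fun i => ?_⟩
  have := (dist_pi_lt_iff hr).1 hy i
  rw [dist_comm, dist_eq_norm] at this
  exact this

/-- The restriction of an absolute value along a field homomorphism. -/
def AbsoluteValue.comap {F E : Type*} [Field F] [Field E] (w : AbsoluteValue E ℝ) (g : F →+* E) :
    AbsoluteValue F ℝ where
  toFun x := w (g x)
  map_mul' x y := by simp
  nonneg' x := w.nonneg _
  eq_zero' x := by simp
  add_le' x y := by simpa using w.add_le _ _

@[simp]
theorem AbsoluteValue.comap_apply {F E : Type*} [Field F] [Field E] (w : AbsoluteValue E ℝ)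
    (g : F →+* E) (x : F) : w.comap g x = w (g x) := rfl

/-- Two equivalent absolute values which agree with the same nontrivial absolute value
on a subfield are equal. -/
theorem AbsoluteValue.IsEquiv.eq_of_comap {F E : Type*} [Field F] [Field E]
    {w w' : AbsoluteValue E ℝ} (g : F →+* E) (hn : (w.comap g).IsNontrivial)
    (h : ∀ x, w (g x) = w' (g x)) (he : w.IsEquiv w') : w = w' := by
  obtain ⟨c, hc, hcw⟩ := AbsoluteValue.isEquiv_iff_exists_rpow_eq.1 he
  obtain ⟨x, hx⟩ := hn.exists_abv_gt_one
  have hx' : 1 < w (g x) := hx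
  have h1 : w (g x) ^ c = w (g x) ^ (1 : ℝ) := by
    rw [Real.rpow_one]
    exact (congrFun hcw (g x)).trans (h x).symm
  have h2 : c = 1 := by
    rcases lt_trichotomy c 1 with hlt | heq | hgt
    · exact absurd h1 (Real.rpow_lt_rpow_of_exponent_lt hx' hlt).ne
    · exact heq
    · exact absurd h1 (Real.rpow_lt_rpow_of_exponent_lt hx' hgt).ne'
  ext y
  rw [← congrFun hcw y, h2]
  simp

/-- A nontrivial nonarchimedean absolute value extends to every algebraic extension. -/
theorem AbsoluteValue.exists_extension {F E : Type*} [Field F] [Field E] [Algebra F E]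
    [Algebra.IsAlgebraic F E] (v : AbsoluteValue F ℝ) (hv : v.IsNontrivial)
    (hna : IsNonarchimedean v) :
    ∃ w : AbsoluteValue E ℝ, ∀ x, w (algebraMap F E x) = v x := by
  have hu : IsUltrametricDist (WithAbs v) :=
    IsUltrametricDist.isUltrametricDist_of_forall_norm_add_le_max_norm fun x y =>
      hna x.ofAbs y.ofAbs
  have hu' : IsUltrametricDist v.Completion := by
    apply IsUltrametricDist.isUltrametricDist_of_forall_norm_natCast_le_one
    intro n
    have h := IsUltrametricDist.norm_natCast_le_one (WithAbs v) n
    have h2 : ((n : WithAbs v) : v.Completion) = (n : v.Completion) :=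
      map_natCast (UniformSpace.Completion.coeRingHom (α := WithAbs v)) n
    rw [← h2, UniformSpace.Completion.norm_coe]
    exact h
  let Fv := v.Completion
  let ι : F →+* Fv := (UniformSpace.Completion.coeRingHom (α := WithAbs v)).comp
    (WithAbs.equiv v).symm.toRingHom
  have hι : ∀ x, ‖ι x‖ = v x := fun x => UniformSpace.Completion.norm_coe _
  obtain ⟨x, hx⟩ := hv.exists_abv_gt_one
  let : NontriviallyNormedField Fv :=
    { (inferInstance : NormedField Fv) with non_trivial := ⟨ι x, by rw [hι]; exact hx⟩ }
  let : Algebra F Fv := ι.toAlgebra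
  let : Algebra F (AlgebraicClosure Fv) := ((algebraMap Fv (AlgebraicClosure Fv)).comp ι).toAlgebra
  let j : E →ₐ[F] AlgebraicClosure Fv := IsAlgClosed.lift
  let := spectralNorm.normedField Fv (AlgebraicClosure Fv)
  let W : AbsoluteValue (AlgebraicClosure Fv) ℝ := NormedField.toAbsoluteValue _
  refine ⟨W.comap j, fun y => ?_⟩
  have : (j : E →+* AlgebraicClosure Fv) (algebraMap F E y)
      = algebraMap Fv (AlgebraicClosure Fv) (ι y) := j.commutes y
  rw [AbsoluteValue.comap_apply, this, ← hι]
  exact spectralNorm_extends (ι y)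

theorem AbsoluteValue.exists_forall_mem_apply_sub_lt {F E : Type*} [Field F] [Field E]
    (g : F →+* E) {v : AbsoluteValue F ℝ} (hv : v.IsNontrivial) (T : Finset (AbsoluteValue E ℝ))
    (hT : ∀ w ∈ T, ∀ x, w (g x) = v x) (z : AbsoluteValue E ℝ → E) {r : ℝ} (hr : 0 < r) :
    ∃ y : E, ∀ w ∈ T, w (y - z w) < r := by
  obtain ⟨x, hx, hx1⟩ := hv
  have hcomap : ∀ w ∈ T, (w.comap g).IsNontrivial := fun w hw =>
    ⟨x, hx, by rw [AbsoluteValue.comap_apply, hT w hw]; exact hx1⟩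
  obtain ⟨y, hy⟩ := AbsoluteValue.exists_forall_apply_sub_lt (ι := T) (v := fun w => w.1)
    (fun w => ⟨g x, by simpa using hx, by rw [hT w.1 w.2]; exact hx1⟩)
    (fun a b hab he => hab <| Subtype.ext <| he.eq_of_comap g (hcomap a.1 a.2)
      fun t => by rw [hT a.1 a.2, hT b.1 b.2]) (fun w => z w.1) hr
  exact ⟨y, fun w hw => hy ⟨w, hw⟩⟩

/-- The Galois group acts transitively on the extensions of an absolute value. -/
theorem AbsoluteValue.exists_comap_eq {F E : Type*} [Field F] [Field E] [Algebra F E]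
    [FiniteDimensional F E] [IsGalois F E] {v : AbsoluteValue F ℝ} (hv : v.IsNontrivial)
    {w w' : AbsoluteValue E ℝ} (hna : IsNonarchimedean w')
    (hw : ∀ x, w (algebraMap F E x) = v x) (hw' : ∀ x, w' (algebraMap F E x) = v x) :
    ∃ τ : E ≃ₐ[F] E, ∀ x, w' x = w (τ x) := by
  classical
  by_contra! hcon
  let o : AbsoluteValue E ℝ → (E ≃ₐ[F] E) → AbsoluteValue E ℝ :=
    fun u τ => u.comap (τ : E →+* E)
  have ho : ∀ u τ x, o u τ x = u (τ x) := fun _ _ _ => rfl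
  let A := Finset.univ.image (o w)
  let B := Finset.univ.image (o w')
  have hAB : ∀ τ, o w' τ ∉ A := by
    intro τ hτ
    obtain ⟨σ, -, hσ⟩ := Finset.mem_image.1 hτ
    obtain ⟨x, hx⟩ := hcon (σ * τ⁻¹)
    apply hx
    have := congrArg (fun u : AbsoluteValue E ℝ => u (τ⁻¹ x)) hσ
    simp only [ho] at this
    rw [AlgEquiv.mul_apply, this, ← AlgEquiv.mul_apply, mul_inv_cancel, AlgEquiv.one_apply]
  obtain ⟨y, hy⟩ := AbsoluteValue.exists_forall_mem_apply_sub_lt (algebraMap F E) hv (A ∪ B)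
    (by
      intro u hu
      rcases Finset.mem_union.1 hu with hu | hu <;> obtain ⟨σ, -, rfl⟩ := Finset.mem_image.1 hu
        <;> intro x <;> rw [ho, AlgEquiv.commutes]
      · exact hw x
      · exact hw' x) (fun u => if u ∈ A then 0 else 1) one_pos
  have h1 : ∀ τ : E ≃ₐ[F] E, w (τ y) < 1 := by
    intro τ
    have hmem : o w τ ∈ A := Finset.mem_image_of_mem _ (Finset.mem_univ _)
    have := hy _ (Finset.mem_union_left _ hmem)
    rw [if_pos hmem, sub_zero] at this
    exact this
  have h2 : ∀ τ : E ≃ₐ[F] E, w' (τ y) = 1 := by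
    intro τ
    have hmem : o w' τ ∈ B := Finset.mem_image_of_mem _ (Finset.mem_univ _)
    have := hy _ (Finset.mem_union_right _ hmem)
    rw [if_neg (hAB τ), ho, map_sub, map_one] at this
    have h3 := IsNonarchimedean.add_eq_right_of_lt hna (x := τ y - 1) (y := 1)
      (by rwa [map_one])
    rwa [sub_add_cancel, map_one] at h3
  have h3 : w (algebraMap F E (Algebra.norm F y)) < 1 := by
    rw [Algebra.norm_eq_prod_automorphisms, map_prod]
    calc ∏ τ : E ≃ₐ[F] E, w (τ y) ≤ ∏ τ : E ≃ₐ[F] E, if τ = 1 then w y else 1 := by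
          apply Finset.prod_le_prod (fun _ _ => w.nonneg _)
          intro τ _
          split_ifs with h
          · rw [h, AlgEquiv.one_apply]
          · exact (h1 τ).le
      _ = w y := by rw [Finset.prod_ite_eq' Finset.univ]; simp
      _ < 1 := h1 1
  have h4 : w' (algebraMap F E (Algebra.norm F y)) = 1 := by
    rw [Algebra.norm_eq_prod_automorphisms, map_prod]
    exact Finset.prod_eq_one fun τ _ => h2 τ
  rw [hw] at h3
  rw [hw'] at h4
  exact h3.ne h4

/-- If the decomposition group of `w` is trivial, elements of `E` are simultaneously approximated
by elements of `F` in a linear way. -/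
theorem AbsoluteValue.exists_trace_sub_lt {F E ι : Type*} [Field F] [Field E] [Algebra F E]
    [FiniteDimensional F E] [IsGalois F E] [Finite ι] {v : AbsoluteValue F ℝ}
    (hv : v.IsNontrivial) {w : AbsoluteValue E ℝ} (hna : IsNonarchimedean w)
    (hw : ∀ x, w (algebraMap F E x) = v x)
    (hdec : ∀ τ : E ≃ₐ[F] E, (∀ x, w (τ x) = w x) → τ = 1) (x : ι → E) :
    ∃ η : E, ∀ i, w (algebraMap F E (Algebra.trace F E (η * x i)) - x i) < 1 := by
  classical
  have := Fintype.ofFinite ι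
  let o : (E ≃ₐ[F] E) → AbsoluteValue E ℝ := fun τ => w.comap (τ : E →+* E)
  have ho : ∀ τ x, o τ x = w (τ x) := fun _ _ => rfl
  obtain ⟨C, hC⟩ : ∃ C : ℝ, ∀ q : ι × (E ≃ₐ[F] E), w (q.2 (x q.1)) ≤ C := by
    obtain ⟨C, hC⟩ := (Set.finite_range fun q : ι × (E ≃ₐ[F] E) => w (q.2 (x q.1))).bddAbove
    exact ⟨C, fun q => hC ⟨q, rfl⟩⟩
  have hC0 : 0 < max C 1 := lt_max_of_lt_right one_pos
  have hr : 0 < 1 / max C 1 := by positivity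
  obtain ⟨η, hη⟩ := AbsoluteValue.exists_forall_mem_apply_sub_lt (algebraMap F E) hv
    (Finset.univ.image o)
    (by
      intro u hu
      obtain ⟨σ, -, rfl⟩ := Finset.mem_image.1 hu
      intro x
      rw [ho, AlgEquiv.commutes, hw]) (fun u => if u = w then 1 else 0) hr
  have hmul : ∀ (a : E) (i : ι) (τ : E ≃ₐ[F] E), w a < 1 / max C 1 → w (a * τ (x i)) < 1 := by
    intro a i τ ha
    rw [map_mul]
    calc w a * w (τ (x i)) ≤ w a * max C 1 := by
          gcongr
          exact (hC (i, τ)).trans (le_max_left _ _)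
      _ < 1 / max C 1 * max C 1 := by gcongr
      _ = 1 := by field_simp
  refine ⟨η, fun i => ?_⟩
  rw [trace_eq_sum_automorphisms, ← Finset.add_sum_erase _ _ (Finset.mem_univ (1 : E ≃ₐ[F] E)),
    add_sub_right_comm]
  refine (hna _ _).trans_lt (max_lt ?_ ?_)
  · have h1 := hη (o 1) (Finset.mem_image_of_mem _ (Finset.mem_univ _))
    have h2 : o 1 = w := by ext y; rfl
    rw [if_pos h2, h2] at h1
    have := hmul (η - 1) i 1 h1
    rwa [AlgEquiv.one_apply, sub_mul, one_mul] at this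
  · refine hna.apply_sum_lt one_pos fun τ hτ => ?_
    have h1 := hη (o τ) (Finset.mem_image_of_mem _ (Finset.mem_univ _))
    have h2 : o τ ≠ w := by
      intro h
      refine Finset.ne_of_mem_erase hτ (hdec τ fun y => ?_)
      rw [← ho, h]
    rw [if_neg h2, sub_zero, ho] at h1
    rw [map_mul]
    exact hmul _ i τ h1

/-- An absolute value with a unique extension is detected by Galois invariance. -/
theorem AbsoluteValue.existsUnique_extension {F E : Type*} [Field F] [Field E] [Algebra F E]
    [FiniteDimensional F E] [IsGalois F E] {v : AbsoluteValue F ℝ} (hv : v.IsNontrivial)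
    (hna : IsNonarchimedean v) (hE : ∀ w : AbsoluteValue E ℝ, IsNonarchimedean w)
    (h : ∀ w : AbsoluteValue E ℝ, (∀ x, w (algebraMap F E x) = v x) →
      ∀ (τ : E ≃ₐ[F] E) (x : E), w (τ x) = w x) :
    ∃! w : AbsoluteValue E ℝ, ∀ x, w (algebraMap F E x) = v x := by
  obtain ⟨w, hw⟩ := v.exists_extension (E := E) hv hna
  refine ⟨w, hw, fun w' hw' => ?_⟩
  obtain ⟨τ, hτ⟩ := AbsoluteValue.exists_comap_eq hv (hE w') hw hw'
  ext x
  rw [hτ, h w hw]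

/-- The values of an extension to a finite extension of a discrete valuation are powers of a
single number. -/
theorem AbsoluteValue.exists_forall_eq_zpow {F E : Type*} [Field F] [Field E] [Algebra F E]
    [FiniteDimensional F E] {v : AbsoluteValue F ℝ} {c : ℝ} (hc : 0 < c) (hc1 : c < 1)
    (hv : ∀ x : F, x ≠ 0 → ∃ n : ℤ, v x = c ^ n)
    {w : AbsoluteValue E ℝ} (hna : IsNonarchimedean w) (hw : ∀ x, w (algebraMap F E x) = v x) :
    ∃ γ : ℝ, 0 < γ ∧ γ < 1 ∧ ∀ y : E, y ≠ 0 → ∃ n : ℤ, w y = γ ^ n := by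
  let N := Module.finrank F E
  have hN : N.factorial ≠ 0 := N.factorial_ne_zero
  have hγ : (c ^ ((N.factorial : ℝ)⁻¹)) ^ N.factorial = c := Real.rpow_inv_natCast_pow hc.le hN
  refine ⟨c ^ ((N.factorial : ℝ)⁻¹), by positivity,
    Real.rpow_lt_one hc.le hc1 (by positivity), fun y hy => ?_⟩
  set γ := c ^ ((N.factorial : ℝ)⁻¹)
  have hγ0 : 0 < γ := by positivity
  have hwy : 0 < w y := w.pos hy
  obtain ⟨i, j, hij, hjN, m, hm⟩ :
      ∃ i j : ℕ, i < j ∧ j ≤ N ∧ ∃ m : ℤ, w y ^ (j - i) = c ^ m := by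
    let P := minpoly F y
    have hP : P.natDegree ≤ N := minpoly.natDegree_le y
    have hP0 : P ≠ 0 := minpoly.ne_zero (Algebra.IsIntegral.isIntegral y)
    let t : ℕ → E := fun i => algebraMap F E (P.coeff i) * y ^ i
    have hsum : ∑ i ∈ P.support, t i = 0 := by
      have := minpoly.aeval F y
      rw [Polynomial.aeval_eq_sum_range] at this
      rw [← this]
      refine Finset.sum_subset_zero_on_sdiff ?_ ?_ ?_
      · intro i hi
        exact Finset.mem_range_succ_iff.2 (Polynomial.le_natDegree_of_mem_supp i hi)
      · intro i hi
        have : P.coeff i = 0 := by simpa using (Finset.mem_sdiff.1 hi).2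
        simp [P] at this
        simp [this]
      · intro i _
        simp [t, P, Algebra.smul_def]
    have ht : ∀ i ∈ P.support, t i ≠ 0 := by
      intro i hi
      have := Polynomial.mem_support_iff.1 hi
      simp [t, this, hy]
    obtain ⟨a, ha, hmax⟩ := Finset.exists_max_image P.support (fun i => w (t i))
      (Polynomial.support_nonempty.2 hP0)
    obtain ⟨b, hb, hba, hab⟩ : ∃ b ∈ P.support, b ≠ a ∧ w (t b) = w (t a) := by
      by_contra! hcon
      have := IsNonarchimedean.apply_sum_eq_of_lt hna (fun a => (w.map_neg a).symm) (l := t) ha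
        fun j hj hja => lt_of_le_of_ne (hmax j hj) (hcon j hj hja)
      rw [hsum, map_zero] at this
      exact ht a ha (w.eq_zero.1 this.symm)
    have key : ∀ a ∈ P.support, ∀ b ∈ P.support, a < b → w (t b) = w (t a) →
        ∃ i j : ℕ, i < j ∧ j ≤ N ∧ ∃ m : ℤ, w y ^ (j - i) = c ^ m := by
      intro a ha b hb hab h
      refine ⟨a, b, hab, (Polynomial.le_natDegree_of_mem_supp b hb).trans hP, ?_⟩
      obtain ⟨r, hr⟩ := hv _ (Polynomial.mem_support_iff.1 ha)
      obtain ⟨s, hs⟩ := hv _ (Polynomial.mem_support_iff.1 hb)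
      refine ⟨r - s, ?_⟩
      simp only [t, map_mul, map_pow, hw, hr, hs] at h
      rw [zpow_sub₀ hc.ne', eq_div_iff (zpow_pos hc s).ne']
      have h2 : w y ^ b = w y ^ (b - a) * w y ^ a := by rw [← pow_add]; congr 1; omega
      rw [h2] at h
      have h3 : w y ^ a ≠ 0 := (pow_pos hwy a).ne'
      apply mul_right_cancel₀ h3
      linarith
    rcases lt_or_gt_of_ne hba with h | h
    · exact key b hb a ha h hab.symm
    · exact key a ha b hb h hab
  obtain ⟨q, hq⟩ : j - i ∣ N.factorial := Nat.dvd_factorial (by omega) (by omega)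
  refine ⟨m * q, ?_⟩
  have h1 : w y ^ N.factorial = (γ ^ (m * q)) ^ N.factorial := by
    rw [← zpow_natCast (γ ^ (m * q)), zpow_comm, zpow_natCast, hγ, hq, pow_mul, hm, zpow_mul,
      zpow_natCast]
  exact (pow_left_inj₀ hwy.le (zpow_pos hγ0 _).le hN).1 h1

end AbsoluteValues

section ArtinSchreier

open Polynomial in
theorem pow_char_sub_self_eq_prod (p : ℕ) [Fact p.Prime] {F : Type*} [Field F] [CharP F p]
    (z : F) : z ^ p - z = ∏ i : ZMod p, (z - ZMod.castHom (dvd_refl p) F i) := by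
  have hroots : roots (X ^ p - X : (ZMod p)[X]) = Finset.univ.val := by
    have := FiniteField.roots_X_pow_card_sub_X (ZMod p)
    rwa [ZMod.card p] at this
  have hmonic : (X ^ p - X : (ZMod p)[X]).Monic :=
    monic_X_pow_sub (degree_X_le.trans_lt (by exact_mod_cast (Fact.out : p.Prime).one_lt))
  have h := (GaloisField.splits_zmod_X_pow_sub_X p).eq_prod_roots_of_monic hmonic
  rw [hroots] at h
  have := congrArg (eval₂ (ZMod.castHom (dvd_refl p) F) z) h
  simp only [eval₂_sub, eval₂_pow, eval₂_X] at this
  rw [this]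
  change eval₂ _ z (∏ i : ZMod p, (X - C i)) = _
  rw [eval₂_finsetProd]
  simp only [eval₂_sub, eval₂_X, eval₂_C]

theorem exists_castHom_eq_of_pow_char_eq (p : ℕ) [Fact p.Prime] {F : Type*} [Field F] [CharP F p]
    {z : F} (hz : z ^ p = z) : ∃ i : ZMod p, ZMod.castHom (dvd_refl p) F i = z := by
  have h := pow_char_sub_self_eq_prod p z
  rw [hz, sub_self, eq_comm, Finset.prod_eq_zero_iff] at h
  obtain ⟨i, -, hi⟩ := h
  exact ⟨i, (sub_eq_zero.1 hi).symm⟩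

theorem AbsoluteValue.exists_apply_sub_castHom_lt_one (p : ℕ) [Fact p.Prime] {F : Type*} [Field F]
    [CharP F p] (w : AbsoluteValue F ℝ) {z : F} (hz : w (z ^ p - z) < 1) :
    ∃ i : ZMod p, w (z - ZMod.castHom (dvd_refl p) F i) < 1 := by
  by_contra! h
  rw [pow_char_sub_self_eq_prod p, map_prod] at hz
  refine hz.not_ge ?_
  calc (1 : ℝ) = ∏ _i : ZMod p, 1 := by simp
    _ ≤ _ := Finset.prod_le_prod (fun _ _ => zero_le_one) fun i _ => h i

end ArtinSchreier

section Twist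

variable {k L D : Type*} [Field k] [Field L] [Algebra k L] [AddCommGroup D]
  [DistribMulAction (L ≃ₐ[k] L) D]

/-- The semilinear action of the Galois group on additive maps `D → L`. -/
def galTwist (σ : L ≃ₐ[k] L) (y : D →+ L) : D →+ L where
  toFun d := σ (y (σ⁻¹ • d))
  map_zero' := by simp
  map_add' := by simp

@[simp]
theorem galTwist_apply (σ : L ≃ₐ[k] L) (y : D →+ L) (d : D) :
    galTwist σ y d = σ (y (σ⁻¹ • d)) := rfl

theorem galTwist_mul (σ τ : L ≃ₐ[k] L) (y : D →+ L) :
    galTwist (σ * τ) y = galTwist σ (galTwist τ y) := by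
  ext d
  simp [mul_smul]

theorem galTwist_add (σ : L ≃ₐ[k] L) (y z : D →+ L) :
    galTwist σ (y + z) = galTwist σ y + galTwist σ z := by
  ext d
  simp

theorem galTwist_neg (σ : L ≃ₐ[k] L) (y : D →+ L) :
    galTwist σ (-y) = -galTwist σ y := by
  ext d
  simp

theorem galTwist_sum {ι : Type*} (σ : L ≃ₐ[k] L) (s : Finset ι) (y : ι → D →+ L) :
    galTwist σ (∑ i ∈ s, y i) = ∑ i ∈ s, galTwist σ (y i) := by
  ext d
  simp

/-- Pointwise multiplication of an additive map by a scalar. -/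
def scaleHom (a : L) (y : D →+ L) : D →+ L := (AddMonoidHom.mulLeft a).comp y

@[simp]
theorem scaleHom_apply (a : L) (y : D →+ L) (d : D) : scaleHom a y d = a * y d := rfl

theorem galTwist_scaleHom (σ : L ≃ₐ[k] L) (a : L) (y : D →+ L) :
    galTwist σ (scaleHom a y) = scaleHom (σ a) (galTwist σ y) := by
  ext d
  simp

/-- Averaging over the Galois group produces invariants. -/
theorem galTwist_sum_galTwist [FiniteDimensional k L] (σ : L ≃ₐ[k] L) (y : D →+ L) :
    galTwist σ (∑ ρ : L ≃ₐ[k] L, galTwist ρ y) = ∑ ρ : L ≃ₐ[k] L, galTwist ρ y := by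
  rw [galTwist_sum]
  simp_rw [← galTwist_mul]
  exact Fintype.sum_equiv (Equiv.mulLeft σ) _ _ fun _ => rfl

end Twist

section FrobHom

variable {L D : Type*} [Field L] [AddCommGroup D]

/-- Composition of an additive map with the Frobenius. -/
def frobHom (p : ℕ) [ExpChar L p] (y : D →+ L) : D →+ L := (frobenius L p : L →+ L).comp y

@[simp]
theorem frobHom_apply (p : ℕ) [ExpChar L p] (y : D →+ L) (d : D) : frobHom p y d = y d ^ p := rfl

theorem frobHom_sub (p : ℕ) [ExpChar L p] (y z : D →+ L) :
    frobHom p (y - z) = frobHom p y - frobHom p z := by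
  ext d
  simp [sub_pow_expChar]

end FrobHom

section OrbitSup

variable {k L D : Type*} [Field k] [Field L] [Algebra k L] [AddCommGroup D]

variable (k) in
/-- The supremum of an absolute value over all Galois conjugates of all values of a map. -/
noncomputable def orbitSup (w : AbsoluteValue L ℝ) (y : D →+ L) : ℝ :=
  ⨆ q : (L ≃ₐ[k] L) × D, w (q.1 (y q.2))

theorem orbitSup_neg (w : AbsoluteValue L ℝ) (y : D →+ L) :
    orbitSup k w (-y) = orbitSup k w y := by
  simp [orbitSup]

theorem orbitSup_scaleHom_algebraMap {v : AbsoluteValue k ℝ} {w : AbsoluteValue L ℝ}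
    (hw : ∀ x, w (algebraMap k L x) = v x) (a : k) (y : D →+ L) :
    orbitSup k w (scaleHom (algebraMap k L a) y) = v a * orbitSup k w y := by
  simp only [orbitSup, scaleHom_apply, map_mul, AlgEquiv.commutes, hw]
  rw [Real.mul_iSup_of_nonneg (v.nonneg a)]

variable [FiniteDimensional k L] [Finite D]

theorem le_orbitSup (w : AbsoluteValue L ℝ) (y : D →+ L) (σ : L ≃ₐ[k] L) (d : D) :
    w (σ (y d)) ≤ orbitSup k w y :=
  le_ciSup (f := fun q : (L ≃ₐ[k] L) × D => w (q.1 (y q.2))) (Set.finite_range _).bddAbove (σ, d)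

theorem exists_eq_orbitSup (w : AbsoluteValue L ℝ) (y : D →+ L) :
    ∃ (σ : L ≃ₐ[k] L) (d : D), orbitSup k w y = w (σ (y d)) := by
  obtain ⟨q, hq⟩ := exists_eq_ciSup_of_finite (f := fun q : (L ≃ₐ[k] L) × D => w (q.1 (y q.2)))
  exact ⟨q.1, q.2, hq.symm⟩

theorem orbitSup_lt_iff {w : AbsoluteValue L ℝ} {y : D →+ L} {C : ℝ} :
    orbitSup k w y < C ↔ ∀ (σ : L ≃ₐ[k] L) (d : D), w (σ (y d)) < C := by
  refine ⟨fun h σ d => (le_orbitSup w y σ d).trans_lt h, fun h => ?_⟩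
  obtain ⟨σ, d, hq⟩ := exists_eq_orbitSup (k := k) w y
  rw [hq]
  exact h σ d

theorem orbitSup_nonneg (w : AbsoluteValue L ℝ) (y : D →+ L) : 0 ≤ orbitSup k w y :=
  (w.nonneg _).trans (le_orbitSup w y 1 0)

theorem orbitSup_pos (w : AbsoluteValue L ℝ) {y : D →+ L} (hy : y ≠ 0) : 0 < orbitSup k w y := by
  obtain ⟨d, hd⟩ := DFunLike.ne_iff.1 hy
  exact (w.pos hd).trans_le (le_orbitSup w y 1 d)

theorem orbitSup_add_le {w : AbsoluteValue L ℝ} (hna : IsNonarchimedean w) (y z : D →+ L) :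
    orbitSup k w (y + z) ≤ max (orbitSup k w y) (orbitSup k w z) := by
  obtain ⟨σ, d, hq⟩ := exists_eq_orbitSup (k := k) w (y + z)
  rw [hq, AddMonoidHom.add_apply, map_add]
  exact (hna _ _).trans (max_le_max (le_orbitSup w y σ d) (le_orbitSup w z σ d))

theorem orbitSup_eq_of_sub_lt {w : AbsoluteValue L ℝ} (hna : IsNonarchimedean w) {y z : D →+ L}
    (h : orbitSup k w (y - z) < orbitSup k w z) : orbitSup k w y = orbitSup k w z := by
  have h1 := orbitSup_add_le (k := k) hna (y - z) z
  rw [sub_add_cancel, max_eq_right h.le] at h1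
  refine le_antisymm h1 ?_
  have h2 := orbitSup_add_le (k := k) hna (-(y - z)) y
  rw [orbitSup_neg, neg_sub, sub_add_cancel] at h2
  exact (le_max_iff.1 h2).resolve_left h.not_ge

theorem orbitSup_frobHom (p : ℕ) [ExpChar L p] (w : AbsoluteValue L ℝ) (y : D →+ L) :
    orbitSup k w (frobHom p y) = orbitSup k w y ^ p := by
  apply le_antisymm
  · obtain ⟨σ, d, hq⟩ := exists_eq_orbitSup (k := k) w (frobHom p y)
    rw [hq, frobHom_apply, map_pow, map_pow]
    exact pow_le_pow_left₀ (w.nonneg _) (le_orbitSup w y σ d) _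
  · obtain ⟨σ, d, hq⟩ := exists_eq_orbitSup (k := k) w y
    have := le_orbitSup (k := k) w (frobHom p y) σ d
    rwa [frobHom_apply, map_pow, map_pow, ← hq] at this

theorem orbitSup_pow_eq_of_sub_lt_one {p : ℕ} [ExpChar L p] (hp : 1 < p) {w : AbsoluteValue L ℝ}
    (hna : IsNonarchimedean w) {u z : D →+ L} (hu : 1 < orbitSup k w u)
    (h : orbitSup k w (u - (frobHom p z - z)) < 1) :
    orbitSup k w z ^ p = orbitSup k w u := by
  have h1 : orbitSup k w (frobHom p z - z) = orbitSup k w u := by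
    apply orbitSup_eq_of_sub_lt hna
    rw [← neg_sub, orbitSup_neg]
    exact h.trans hu
  have h2 : 1 < orbitSup k w z := by
    by_contra! hz
    have h3 := orbitSup_add_le (k := k) hna (frobHom p z) (-z)
    rw [← sub_eq_add_neg, h1, orbitSup_neg, orbitSup_frobHom] at h3
    exact (hu.trans_le h3).not_ge (max_le (pow_le_one₀ (orbitSup_nonneg w z) hz) hz)
  rw [← h1, ← orbitSup_frobHom, eq_comm]
  apply orbitSup_eq_of_sub_lt hna
  rw [sub_sub_cancel_left, orbitSup_neg, orbitSup_frobHom]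
  exact lt_self_pow₀ h2 hp

variable [DistribMulAction (L ≃ₐ[k] L) D]

theorem exists_apply_galTwist_sub_castHom_lt_one {p : ℕ} [Fact p.Prime] [CharP L p]
    {w : AbsoluteValue L ℝ} (hna : IsNonarchimedean w) {u y : D →+ L}
    (hu : ∀ σ : L ≃ₐ[k] L, galTwist σ u = u)
    (hy : orbitSup k w (u - (frobHom p y - y)) < 1) (σ τ : L ≃ₐ[k] L) (d : D) :
    ∃ i : ZMod p, w (τ ((galTwist σ y - y) d) - ZMod.castHom (dvd_refl p) L i) < 1 := by
  apply AbsoluteValue.exists_apply_sub_castHom_lt_one p w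
  have key : τ ((galTwist σ y - y) d) ^ p - τ ((galTwist σ y - y) d) =
      τ ((u - (frobHom p y - y)) d) - (τ * σ) ((u - (frobHom p y - y)) (σ⁻¹ • d)) := by
    have h1 : σ (u (σ⁻¹ • d)) = u d := by rw [← galTwist_apply, hu]
    simp only [AddMonoidHom.sub_apply, galTwist_apply, frobHom_apply, AlgEquiv.mul_apply,
      map_sub, map_pow, h1, sub_pow_char]
    ring
  rw [key]
  exact hna.apply_sub_lt (orbitSup_lt_iff.1 hy _ _) (orbitSup_lt_iff.1 hy _ _)

variable [IsGalois k L]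

theorem orbitSup_average {w : AbsoluteValue L ℝ} (hna : IsNonarchimedean w) {z : D →+ L}
    (hz : ∀ σ : L ≃ₐ[k] L, orbitSup k w (galTwist σ z - z) < 1) {θ : L}
    (hθ : Algebra.trace k L θ = 1) {C : ℝ} (hC : ∀ σ : L ≃ₐ[k] L, w (σ θ) ≤ C)
    (hCz : C < orbitSup k w z) :
    orbitSup k w (∑ ρ : L ≃ₐ[k] L, galTwist ρ (scaleHom θ z)) = orbitSup k w z := by
  apply orbitSup_eq_of_sub_lt hna
  have hC0 : 0 < C := (w.pos (by rintro rfl; simp at hθ)).trans_le (hC 1)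
  have hz' : z = ∑ ρ : L ≃ₐ[k] L, scaleHom (ρ θ) z := by
    ext d
    rw [AddMonoidHom.finsetSum_apply]
    simp only [scaleHom_apply]
    rw [← Finset.sum_mul, ← trace_eq_sum_automorphisms, hθ, map_one, one_mul]
  rw [orbitSup_lt_iff]
  intro τ d
  have hsub : (∑ ρ : L ≃ₐ[k] L, galTwist ρ (scaleHom θ z) - z) d =
      ∑ ρ : L ≃ₐ[k] L, ρ θ * (galTwist ρ z - z) d := by
    conv_lhs => rw [hz']
    rw [← Finset.sum_sub_distrib, AddMonoidHom.finsetSum_apply]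
    refine Finset.sum_congr rfl fun ρ _ => ?_
    rw [← hz', galTwist_scaleHom, AddMonoidHom.sub_apply, AddMonoidHom.sub_apply, mul_sub]
    simp
  rw [hsub, map_sum]
  refine lt_of_lt_of_le (hna.apply_sum_lt hC0 fun ρ _ => ?_) hCz.le
  rw [map_mul, map_mul]
  have h1 := orbitSup_lt_iff.1 (hz ρ) τ d
  calc w (τ (ρ θ)) * w (τ ((galTwist ρ z - z) d))
      ≤ C * w (τ ((galTwist ρ z - z) d)) := by
        gcongr
        exact hC (τ * ρ)
    _ < C * 1 := by gcongr
    _ = C := mul_one C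

/-- If every invariant `u` is an Artin-Schreier value up to small elements, then up to a common
scaling the sizes of invariants are `p`-th powers of sizes of invariants. -/
theorem exists_invariant_orbitSup_pow_eq {p : ℕ} [Fact p.Prime] [CharP L p]
    {v : AbsoluteValue k ℝ} {w : AbsoluteValue L ℝ} (hna : IsNonarchimedean w)
    (hvna : IsNonarchimedean v)
    (hw : ∀ x, w (algebraMap k L x) = v x) {t : k} (ht0 : t ≠ 0) (ht : v t < 1)
    (hcon : ∀ u : D →+ L, (∀ σ : L ≃ₐ[k] L, galTwist σ u = u) →
      ∃ y : D →+ L, orbitSup k w (u - (frobHom p y - y)) < 1)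
    (u : Bool → D →+ L) (hu : ∀ b, ∀ σ : L ≃ₐ[k] L, galTwist σ (u b) = u b) (hu0 : ∀ b, u b ≠ 0) :
    ∃ (s : ℕ) (z : Bool → D →+ L), (∀ b, ∀ σ : L ≃ₐ[k] L, galTwist σ (z b) = z b) ∧
      ∀ b, orbitSup k w (z b) ^ p * v t ^ s = orbitSup k w (u b) := by
  have hp : 1 < p := (Fact.out : p.Prime).one_lt
  have hvt : 0 < v t := v.pos ht0
  let U : k → Bool → D →+ L := fun a b => scaleHom (algebraMap k L a) (u b)
  have hU : ∀ a b (σ : L ≃ₐ[k] L), galTwist σ (U a b) = U a b := by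
    intro a b σ
    simp only [U]
    rw [galTwist_scaleHom, AlgEquiv.commutes, hu]
  choose Y hY using fun s b => hcon (U (t⁻¹ ^ s) b) (hU _ b)
  choose cl hcl using fun (s : ℕ) (b : Bool) (σ τ : L ≃ₐ[k] L) (d : D) =>
    exists_apply_galTwist_sub_castHom_lt_one hna (hU (t⁻¹ ^ s) b) (hY s b) σ τ d
  obtain ⟨θ, hθ⟩ := Algebra.trace_surjective k L 1
  obtain ⟨C, hC⟩ : ∃ C : ℝ, ∀ σ : L ≃ₐ[k] L, w (σ θ) ≤ C := by
    obtain ⟨C, hC⟩ := (Set.finite_range fun σ : L ≃ₐ[k] L => w (σ θ)).bddAbove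
    exact ⟨C, fun q => hC ⟨q, rfl⟩⟩
  have hC0 : 0 ≤ C := (w.nonneg _).trans (hC 1)
  obtain ⟨s₀, hs₀⟩ : ∃ s₀ : ℕ, ∀ s, s₀ ≤ s → ∀ b,
      max 1 (C ^ p) < (v t)⁻¹ ^ s * orbitSup k w (u b) := by
    have h1 : 1 < (v t)⁻¹ := (one_lt_inv₀ hvt).2 ht
    have h2 : ∀ b, ∃ n : ℕ, max 1 (C ^ p) / orbitSup k w (u b) < (v t)⁻¹ ^ n := fun b =>
      pow_unbounded_of_one_lt _ h1
    choose n hn using h2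
    refine ⟨max (n true) (n false), fun s hs b => ?_⟩
    rw [← div_lt_iff₀ (orbitSup_pos w (hu0 b))]
    refine (hn b).trans_le (pow_le_pow_right₀ h1.le (le_trans ?_ hs))
    cases b
    · exact le_max_right _ _
    · exact le_max_left _ _
  have := Fintype.ofFinite D
  classical
  obtain ⟨i, j, hij, hcl_eq⟩ := Finite.exists_ne_map_eq_of_infinite fun n : ℕ => cl (n + s₀)
  obtain ⟨s₁, s₂, hs₁, hs, hcl_eq⟩ : ∃ s₁ s₂, s₀ ≤ s₁ ∧ s₁ < s₂ ∧ cl s₁ = cl s₂ := by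
    rcases lt_or_gt_of_ne hij with h | h
    · exact ⟨i + s₀, j + s₀, by omega, by omega, hcl_eq⟩
    · exact ⟨j + s₀, i + s₀, by omega, by omega, hcl_eq.symm⟩
  let z : Bool → D →+ L := fun b => Y s₂ b - Y s₁ b
  let a : k := t⁻¹ ^ s₂ - t⁻¹ ^ s₁
  have ha : v a = (v t)⁻¹ ^ s₂ := by
    have h := IsNonarchimedean.add_eq_right_of_lt hvna (x := -t⁻¹ ^ s₁) (y := t⁻¹ ^ s₂)
      (by
        rw [v.map_neg, map_pow, map_pow, map_inv₀]
        exact pow_lt_pow_right₀ ((one_lt_inv₀ hvt).2 ht) hs)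
    rw [neg_add_eq_sub, map_pow, map_inv₀] at h
    exact h
  have hzU : ∀ b, orbitSup k w (U a b - (frobHom p (z b) - z b)) < 1 := by
    intro b
    rw [orbitSup_lt_iff]
    intro τ d
    have : (U a b - (frobHom p (z b) - z b)) d =
        (U (t⁻¹ ^ s₂) b - (frobHom p (Y s₂ b) - Y s₂ b)) d -
        (U (t⁻¹ ^ s₁) b - (frobHom p (Y s₁ b) - Y s₁ b)) d := by
      simp only [U, z, a, AddMonoidHom.sub_apply, scaleHom_apply, frobHom_apply, sub_pow_char,
        map_sub]
      ring
    rw [this, map_sub]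
    exact hna.apply_sub_lt (orbitSup_lt_iff.1 (hY s₂ b) τ d) (orbitSup_lt_iff.1 (hY s₁ b) τ d)
  have hzσ : ∀ b (σ : L ≃ₐ[k] L), orbitSup k w (galTwist σ (z b) - z b) < 1 := by
    intro b σ
    rw [orbitSup_lt_iff]
    intro τ d
    have h1 := hcl s₁ b σ τ d
    have h2 := hcl s₂ b σ τ d
    rw [hcl_eq] at h1
    have h3 := hna.apply_sub_lt h2 h1
    rw [sub_sub_sub_cancel_right, ← map_sub] at h3
    convert h3 using 3
    simp only [z, AddMonoidHom.sub_apply, galTwist_apply, map_sub]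
    ring
  have hUa : ∀ b, orbitSup k w (U a b) = (v t)⁻¹ ^ s₂ * orbitSup k w (u b) := by
    intro b
    simp only [U]
    rw [orbitSup_scaleHom_algebraMap hw, ha]
  have hlarge : ∀ b, max 1 (C ^ p) < orbitSup k w (U a b) := by
    intro b
    rw [hUa]
    exact hs₀ s₂ (by omega) b
  have hz : ∀ b, orbitSup k w (z b) ^ p = orbitSup k w (U a b) := fun b =>
    orbitSup_pow_eq_of_sub_lt_one hp hna ((le_max_left _ _).trans_lt (hlarge b)) (hzU b)
  have hCz : ∀ b, C < orbitSup k w (z b) := by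
    intro b
    apply lt_of_pow_lt_pow_left₀ p (orbitSup_nonneg w _)
    rw [hz]
    exact (le_max_right _ _).trans_lt (hlarge b)
  refine ⟨s₂, fun b => ∑ ρ : L ≃ₐ[k] L, galTwist ρ (scaleHom θ (z b)),
    fun b σ => galTwist_sum_galTwist σ _, fun b => ?_⟩
  rw [orbitSup_average hna (hzσ b) hθ hC (hCz b), hz, hUa, inv_pow]
  field_simp

theorem exists_invariant_forall_one_le (p : ℕ) [Fact p.Prime] [CharP L p]
    {v : AbsoluteValue k ℝ} {w : AbsoluteValue L ℝ} (hna : IsNonarchimedean w)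
    (hvna : IsNonarchimedean v) (hw : ∀ x, w (algebraMap k L x) = v x)
    {c : ℝ} (hc : 0 < c) (hc1 : c < 1) (hvc : ∃ t, v t = c)
    (hv : ∀ x : k, x ≠ 0 → ∃ n : ℤ, v x = c ^ n)
    {e : D →+ L} (he : e ≠ 0) (hinv : ∀ σ : L ≃ₐ[k] L, galTwist σ e = e) :
    ∃ u : D →+ L, (∀ σ : L ≃ₐ[k] L, galTwist σ u = u) ∧
      ∀ y : D →+ L, 1 ≤ orbitSup k w (u - (frobHom p y - y)) := by
  by_contra! hcon
  obtain ⟨t, ht⟩ := hvc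
  have ht0 : t ≠ 0 := by
    rintro rfl
    rw [map_zero] at ht
    exact hc.ne ht
  obtain ⟨γ, hγ, hγ1, hwγ⟩ := AbsoluteValue.exists_forall_eq_zpow hc hc1 hv hna hw
  have hnrm : ∀ y : D →+ L, y ≠ 0 → ∃ n : ℤ, orbitSup k w y = γ ^ n := by
    intro y hy
    obtain ⟨σ, d, hq⟩ := exists_eq_orbitSup (k := k) w y
    have h := orbitSup_pos (k := k) w hy
    rw [hq] at h ⊢
    exact hwγ _ (w.pos_iff.1 h)
  have hinj : ∀ a b : ℤ, γ ^ a = γ ^ b → a = b := fun a b h =>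
    zpow_right_injective₀ hγ hγ1.ne h
  have main : ∀ m : ℕ, 0 < m → ∀ u : Bool → D →+ L,
      (∀ b, ∀ σ : L ≃ₐ[k] L, galTwist σ (u b) = u b) → (∀ b, u b ≠ 0) →
      orbitSup k w (u true) ≠ γ ^ m * orbitSup k w (u false) := by
    intro m
    induction m using Nat.strong_induction_on with
    | _ m ih =>
    intro hm u hu hu0 heq
    obtain ⟨s, z, hz, hzu⟩ := exists_invariant_orbitSup_pow_eq hna hvna hw ht0
      (by rw [ht]; exact hc1) hcon u hu hu0
    have hp := (Fact.out : p.Prime).two_le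
    have hz0 : ∀ b, z b ≠ 0 := by
      intro b hb
      have h1 := hzu b
      have h2 : orbitSup k w (0 : D →+ L) = 0 := by simp [orbitSup]
      rw [hb, h2, zero_pow (by omega), zero_mul] at h1
      exact (orbitSup_pos w (hu0 b)).ne h1
    obtain ⟨a, ha⟩ := hnrm _ (hz0 true)
    obtain ⟨b, hb⟩ := hnrm _ (hz0 false)
    have h1 : (γ ^ a) ^ p = γ ^ m * (γ ^ b) ^ p := by
      have h2 : v t ^ s ≠ 0 := pow_ne_zero _ (v.ne_zero ht0)
      apply mul_right_cancel₀ h2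
      rw [← ha, ← hb, hzu, heq, mul_assoc, hzu]
    have h3 : a * p = m + b * p := by
      apply hinj
      rw [zpow_add₀ hγ.ne', zpow_mul, zpow_mul, zpow_natCast, zpow_natCast, zpow_natCast]
      exact h1
    have h4 : (a - b) * p = m := by linarith
    have h5 : 0 < a - b := by
      by_contra! h
      have : (a - b) * p ≤ 0 := mul_nonpos_of_nonpos_of_nonneg h (by positivity)
      omega
    obtain ⟨m', hm'⟩ := Int.eq_ofNat_of_zero_le h5.le
    refine ih m' ?_ (by omega) z hz hz0 ?_
    · have : (m' : ℤ) * p = m := by rw [← hm', h4]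
      have h6 : m' * p = m := by exact_mod_cast this
      have : 0 < m' := by omega
      nlinarith
    · rw [ha, hb, ← zpow_natCast, ← zpow_add₀ hγ.ne', ← hm']
      congr 1
      ring
  obtain ⟨n, hn⟩ := hwγ (algebraMap k L t) (by simpa using ht0)
  have hn' : c = γ ^ n := by rw [← hn, hw, ht]
  have hn0 : 0 < n := by
    by_contra! h
    have : 1 ≤ γ ^ n := one_le_zpow_of_nonpos₀ hγ hγ1.le h
    linarith
  obtain ⟨m, rfl⟩ := Int.eq_ofNat_of_zero_le hn0.le
  refine main m (by omega) (fun b => if b then scaleHom (algebraMap k L t) e else e) ?_ ?_ ?_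
  · intro b σ
    cases b
    · simpa using hinv σ
    · simp [galTwist_scaleHom, hinv]
  · intro b
    cases b
    · simpa using he
    · obtain ⟨d, hd⟩ := DFunLike.ne_iff.1 he
      refine DFunLike.ne_iff.2 ⟨d, ?_⟩
      simpa [ht0] using hd
  · simp only [if_true, Bool.false_eq_true, if_false]
    rw [orbitSup_scaleHom_algebraMap hw, ht, hn', zpow_natCast]

end OrbitSup

section Crossed

theorem exists_sum_algEquiv_eq_one (k L : Type*) [Field k] [Field L] [Algebra k L]
    [FiniteDimensional k L] [IsGalois k L] : ∃ θ : L, ∑ ρ : L ≃ₐ[k] L, ρ θ = 1 := by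
  obtain ⟨θ, hθ⟩ := Algebra.trace_surjective k L 1
  refine ⟨θ, ?_⟩
  rw [← trace_eq_sum_automorphisms, hθ, map_one]

variable {k L D Γ : Type*} [Field k] [Field L] [Algebra k L] [FiniteDimensional k L]
  [AddCommGroup D] [DistribMulAction (L ≃ₐ[k] L) D]

/-- If there are nonzero additive maps, then there are nonzero invariant ones. -/
theorem exists_invariant_ne_zero {y : D →+ L} (hy : y ≠ 0) :
    ∃ e : D →+ L, e ≠ 0 ∧ ∀ σ : L ≃ₐ[k] L, galTwist σ e = e := by
  obtain ⟨d, hd⟩ := DFunLike.ne_iff.1 hy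
  by_contra! h
  have h0 : ∀ l : L, ∑ ρ : L ≃ₐ[k] L, galTwist ρ (scaleHom l y) = 0 := by
    intro l
    by_contra hl
    obtain ⟨σ, hσ⟩ := h _ hl
    exact hσ (galTwist_sum_galTwist σ _)
  have hli := linearIndependent_monoidHom L L
  have hinj : Function.Injective fun σ : L ≃ₐ[k] L => ((σ : L →+* L) : L →* L) := by
    intro σ τ hστ
    ext x
    exact DFunLike.congr_fun hστ x
  have := Fintype.linearIndependent_iff.1 (hli.comp _ hinj) (fun ρ => ρ (y (ρ⁻¹ • d))) (by
    ext l
    have := DFunLike.congr_fun (h0 l) d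
    simpa [AddMonoidHom.finsetSum_apply, mul_comm] using this) 1
  exact hd (by simpa using this)

variable [IsGalois k L] [Group Γ] {f : Γ →* (L ≃ₐ[k] L)}

/-- An equivariant homomorphism on the kernel of `f` extends to a crossed homomorphism. -/
theorem exists_crossed_of_ker (hf : Function.Surjective f) (j : f.ker → (D →+ L))
    (hmul : ∀ a b, j (a * b) = j a + j b)
    (hconj : ∀ γ a, j (MulAut.conjNormal γ a) = galTwist (f γ) (j a)) :
    ∃ B : Γ → (D →+ L), (∀ γ δ, B (γ * δ) = B γ + galTwist (f γ) (B δ)) ∧ ∀ a : f.ker, B a = j a := by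
  obtain ⟨θ, hθ⟩ := exists_sum_algEquiv_eq_one k L
  obtain ⟨s, hs⟩ := hf.hasRightInverse
  let ν : Γ → f.ker := fun γ => ⟨γ * (s (f γ))⁻¹, by simp [MonoidHom.mem_ker, hs (f γ)]⟩
  refine ⟨fun γ => ∑ ρ : L ≃ₐ[k] L, scaleHom (f γ (ρ θ)) (j (ν (γ * s ρ))), fun γ δ => ?_,
    fun a => ?_⟩
  · have hν : ∀ ρ, ν (γ * δ * s ρ) =
        ν (γ * s (f δ * ρ)) * (ν (γ * s (f δ * ρ)))⁻¹ *
        (MulAut.conjNormal γ (ν (δ * s ρ)) * ν (γ * s (f δ * ρ))) := by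
      intro ρ
      ext
      simp [ν, hs _, mul_assoc]
    have h1 : ∀ ρ, j (ν (γ * δ * s ρ)) =
        galTwist (f γ) (j (ν (δ * s ρ))) + j (ν (γ * s (f δ * ρ))) := by
      intro ρ
      rw [hν, mul_inv_cancel, one_mul, hmul, hconj]
    have h2 : ∑ ρ : L ≃ₐ[k] L, scaleHom (f γ (ρ θ)) (j (ν (γ * s ρ))) =
        ∑ ρ : L ≃ₐ[k] L, scaleHom (f γ ((f δ * ρ) θ)) (j (ν (γ * s (f δ * ρ)))) :=
      (Fintype.sum_equiv (Equiv.mulLeft (f δ)) _ _ fun _ => rfl).symm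
    dsimp only
    rw [h2, galTwist_sum, ← Finset.sum_add_distrib]
    refine Finset.sum_congr rfl fun ρ _ => ?_
    rw [h1, galTwist_scaleHom]
    ext d
    simp only [AddMonoidHom.add_apply, scaleHom_apply, map_mul, AlgEquiv.mul_apply, mul_add]
    exact add_comm _ _
  · have h1 : ∀ ρ, ν (a * s ρ) = a := by
      intro ρ
      ext
      have : f a = 1 := a.2
      simp [ν, hs _, this]
    have h2 : f a = 1 := a.2
    ext d
    simp only [h1, h2, AddMonoidHom.finsetSum_apply, AlgEquiv.one_apply, scaleHom_apply]
    rw [← Finset.sum_mul, hθ, one_mul]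

/-- A crossed homomorphism vanishing on the kernel of `f` is principal. -/
theorem exists_galTwist_sub_eq_of_crossed (hf : Function.Surjective f) (C : Γ → (D →+ L))
    (hC : ∀ γ δ, C (γ * δ) = C γ + galTwist (f γ) (C δ)) (hC1 : ∀ γ, f γ = 1 → C γ = 0) :
    ∃ a : D →+ L, ∀ γ, galTwist (f γ) a - a = C γ := by
  obtain ⟨θ, hθ⟩ := exists_sum_algEquiv_eq_one k L
  obtain ⟨s, hs⟩ := hf.hasRightInverse
  have hone : ∀ y : D →+ L, galTwist (1 : L ≃ₐ[k] L) y = y := fun y => by ext; simp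
  have hker : ∀ γ δ, f γ = f δ → C γ = C δ := by
    intro γ δ h
    have := hC (γ * δ⁻¹) δ
    rw [inv_mul_cancel_right, hC1 (γ * δ⁻¹) (by simp [h]), zero_add] at this
    rw [this, map_mul, map_inv, h, mul_inv_cancel, hone]
  refine ⟨-∑ ρ : L ≃ₐ[k] L, scaleHom (ρ θ) (C (s ρ)), fun γ => ?_⟩
  have h1 : ∀ ρ, galTwist (f γ) (C (s ρ)) = C (s (f γ * ρ)) - C γ := by
    intro ρ
    rw [eq_sub_iff_add_eq', ← hC]
    exact hker _ _ (by simp [hs _])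
  have h2 : ∑ ρ : L ≃ₐ[k] L, scaleHom (ρ θ) (C (s ρ)) =
      ∑ ρ : L ≃ₐ[k] L, scaleHom ((f γ * ρ) θ) (C (s (f γ * ρ))) :=
    (Fintype.sum_equiv (Equiv.mulLeft (f γ)) _ _ fun _ => rfl).symm
  have h3 : ∑ ρ : L ≃ₐ[k] L, f γ (ρ θ) = 1 := by rw [← map_sum, hθ, map_one]
  rw [galTwist_neg, galTwist_sum, neg_sub_neg]
  nth_rewrite 1 [h2]
  rw [← Finset.sum_sub_distrib]
  ext d
  simp only [galTwist_scaleHom, h1, AddMonoidHom.finsetSum_apply, AddMonoidHom.sub_apply,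
    scaleHom_apply, AlgEquiv.mul_apply, mul_sub, sub_sub_cancel]
  rw [← Finset.sum_mul, h3, one_mul]

end Crossed

section Approximation

variable {k L D : Type*} [Field k] [Field L] [Algebra k L] [FiniteDimensional k L]
  [AddCommGroup D] [Finite D]

theorem orbitSup_add_lt {w : AbsoluteValue L ℝ} (hna : IsNonarchimedean w) {y z : D →+ L} {C : ℝ}
    (hy : orbitSup k w y < C) (hz : orbitSup k w z < C) : orbitSup k w (y + z) < C :=
  (orbitSup_add_le hna y z).trans_lt (max_lt hy hz)

theorem orbitSup_sub_lt {w : AbsoluteValue L ℝ} (hna : IsNonarchimedean w) {y z : D →+ L} {C : ℝ}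
    (hy : orbitSup k w y < C) (hz : orbitSup k w z < C) : orbitSup k w (y - z) < C := by
  rw [sub_eq_add_neg]
  exact orbitSup_add_lt hna hy (by rwa [orbitSup_neg])

variable [DistribMulAction (L ≃ₐ[k] L) D]

/-- Weak approximation for invariant additive maps. -/
theorem exists_invariant_forall_orbitSup_sub_lt {ι : Type*} [Finite ι]
    {v : ι → AbsoluteValue k ℝ} {w : ι → AbsoluteValue L ℝ} (hna : ∀ i, IsNonarchimedean (w i))
    (hw : ∀ i x, w i (algebraMap k L x) = v i x) (hnt : ∀ i, (v i).IsNontrivial)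
    (hv : Pairwise fun i j => ¬ (v i).IsEquiv (v j)) (u : ι → D →+ L)
    (hinv : ∀ i, ∀ σ : L ≃ₐ[k] L, galTwist σ (u i) = u i) :
    ∃ u' : D →+ L, (∀ σ : L ≃ₐ[k] L, galTwist σ u' = u') ∧
      ∀ i, orbitSup k (w i) (u' - u i) < 1 := by
  classical
  have := Fintype.ofFinite ι
  obtain ⟨M, hM⟩ := (Set.finite_range fun q : ι × ι => orbitSup k (w q.1) (u q.2)).bddAbove
  replace hM : ∀ i j, orbitSup k (w i) (u j) ≤ M := fun i j => hM ⟨(i, j), rfl⟩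
  have hM1 : 0 < |M| + 1 := by positivity
  choose ε hε using fun j => AbsoluteValue.exists_forall_apply_sub_lt hnt hv
    (fun i => if i = j then 1 else 0) (inv_pos.2 hM1)
  refine ⟨∑ j, scaleHom (algebraMap k L (ε j)) (u j), fun σ => ?_, fun i => ?_⟩
  · simp [galTwist_sum, galTwist_scaleHom, hinv]
  · rw [orbitSup_lt_iff]
    intro σ d
    have h1 : σ ((∑ j, scaleHom (algebraMap k L (ε j)) (u j) - u i) d) =
        ∑ j, algebraMap k L (ε j - if i = j then 1 else 0) * σ (u j d) := by
      simp only [map_sub, sub_mul, Finset.sum_sub_distrib, AddMonoidHom.sub_apply,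
        AddMonoidHom.finsetSum_apply, map_sum, scaleHom_apply, map_mul, AlgEquiv.commutes]
      simp [apply_ite (algebraMap k L)]
    rw [h1]
    refine (hna i).apply_sum_lt zero_lt_one fun j _ => ?_
    rw [map_mul, hw]
    calc _ ≤ v i (ε j - if i = j then 1 else 0) * |M| :=
          mul_le_mul_of_nonneg_left
            (((le_orbitSup (w i) (u j) σ d).trans (hM i j)).trans (le_abs_self M)) ((v i).nonneg _)
      _ ≤ (|M| + 1)⁻¹ * |M| := mul_le_mul_of_nonneg_right (hε j i).le (abs_nonneg M)
      _ < 1 := by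
        rw [inv_mul_lt_one₀ hM1]
        exact lt_add_one _

variable [IsGalois k L]

/-- An additive map can be translated by an invariant one so as to avoid, at finitely many places,
the neighbourhoods of the image of the Artin-Schreier map. -/
theorem exists_invariant_forall_one_le_add (p : ℕ) [Fact p.Prime] [CharP L p]
    {ι : Type*} [Finite ι]
    {v : ι → AbsoluteValue k ℝ} {w : ι → AbsoluteValue L ℝ} (hna : ∀ i, IsNonarchimedean (w i))
    (hvna : ∀ i, IsNonarchimedean (v i)) (hw : ∀ i x, w i (algebraMap k L x) = v i x)
    (hnt : ∀ i, (v i).IsNontrivial)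
    (hdisc : ∀ i, ∃ c : ℝ, 0 < c ∧ c < 1 ∧ (∃ t, v i t = c) ∧
      ∀ x : k, x ≠ 0 → ∃ n : ℤ, v i x = c ^ n)
    (hv : Pairwise fun i j => ¬ (v i).IsEquiv (v j))
    {e : D →+ L} (he : e ≠ 0) (hinv : ∀ σ : L ≃ₐ[k] L, galTwist σ e = e) (a : D →+ L) :
    ∃ u : D →+ L, (∀ σ : L ≃ₐ[k] L, galTwist σ u = u) ∧
      ∀ i, ∀ y : D →+ L, 1 ≤ orbitSup k (w i) (a + u - (frobHom p y - y)) := by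
  have hloc : ∀ i, ∃ u : D →+ L, (∀ σ : L ≃ₐ[k] L, galTwist σ u = u) ∧
      ∀ y : D →+ L, 1 ≤ orbitSup k (w i) (a + u - (frobHom p y - y)) := by
    intro i
    by_cases ha : ∀ y : D →+ L, 1 ≤ orbitSup k (w i) (a - (frobHom p y - y))
    · refine ⟨0, fun σ => by ext; simp, ?_⟩
      simpa using ha
    push Not at ha
    obtain ⟨y₀, hy₀⟩ := ha
    obtain ⟨c, hc, hc1, hvc, hvz⟩ := hdisc i
    obtain ⟨u, hu, hu1⟩ := exists_invariant_forall_one_le p (hna i) (hvna i) (hw i) hc hc1 hvc hvz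
      he hinv
    refine ⟨u, hu, fun y => ?_⟩
    by_contra! hlt
    refine (hu1 (y - y₀)).not_gt ?_
    have : u - (frobHom p (y - y₀) - (y - y₀)) =
        (a + u - (frobHom p y - y)) - (a - (frobHom p y₀ - y₀)) := by
      rw [frobHom_sub]
      abel
    rw [this]
    exact orbitSup_sub_lt (hna i) hlt hy₀
  choose u hu hu1 using hloc
  obtain ⟨u', hu', hlt⟩ := exists_invariant_forall_orbitSup_sub_lt hna hw hnt hv u hu
  refine ⟨u', hu', fun i y => ?_⟩
  by_contra! hcon
  refine (hu1 i y).not_gt ?_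
  have : a + u i - (frobHom p y - y) = (a + u' - (frobHom p y - y)) - (u' - u i) := by abel
  rw [this]
  exact orbitSup_sub_lt (hna i) hcon (hlt i)

end Approximation

section Groups

/-- A subgroup complementing a minimal normal abelian kernel is trivial on it or everything. -/
theorem Subgroup.inf_ker_eq_bot_or_eq_top {Γ G : Type*} [Group Γ] [Group G] {f : Γ →* G}
    (hcomm : ∀ a ∈ f.ker, ∀ b ∈ f.ker, a * b = b * a)
    (hmin : ∀ H : Subgroup Γ, H.Normal → H ≤ f.ker → H = ⊥ ∨ H = f.ker)
    {H : Subgroup Γ} (hH : ∀ γ, ∃ h ∈ H, f h = f γ) : H ⊓ f.ker = ⊥ ∨ H = ⊤ := by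
  have hn : (H ⊓ f.ker).Normal := by
    refine ⟨fun n hn γ => ?_⟩
    obtain ⟨h, hh, hhγ⟩ := hH γ
    have hz : h⁻¹ * γ ∈ f.ker := by simp [MonoidHom.mem_ker, hhγ]
    have : γ * n * γ⁻¹ = h * n * h⁻¹ := by
      calc γ * n * γ⁻¹ = h * (h⁻¹ * γ * n) * (h⁻¹ * γ)⁻¹ * h⁻¹ := by group
        _ = h * n * h⁻¹ := by rw [hcomm _ hz _ hn.2]; group
    rw [this]
    exact ⟨H.mul_mem (H.mul_mem hh hn.1) (H.inv_mem hh),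
      (inferInstance : f.ker.Normal).conj_mem _ hn.2 _⟩
  refine (hmin _ hn inf_le_right).imp_right fun h => ?_
  rw [inf_eq_right] at h
  refine eq_top_iff.2 fun γ _ => ?_
  obtain ⟨g, hg, hgγ⟩ := hH γ
  have : g⁻¹ * γ ∈ H := h (by simp [MonoidHom.mem_ker, hgγ])
  simpa using H.mul_mem hg this

end Groups

section Solution

variable {k L K D Γ : Type*} [Field k] [Field L] [Field K] [Algebra k L] [Algebra k K]
  [Algebra L K] [IsScalarTower k L K] [Normal k L]
  [AddCommGroup D] [DistribMulAction (L ≃ₐ[k] L) D] [Group Γ]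

/-- The automorphism `g` acts on `x` through the crossed homomorphism `B` as `γ` does. -/
def ActsVia (f : Γ →* (L ≃ₐ[k] L)) (B : Γ → (D →+ L)) (x : D →+ K) (g : K ≃ₐ[k] K) (γ : Γ) :
    Prop :=
  f γ = g.restrictNormal L ∧ ∀ d, g (x d) = x (f γ • d) + algebraMap L K (B γ (f γ • d))

variable {f : Γ →* (L ≃ₐ[k] L)} {B : Γ → (D →+ L)} {x : D →+ K}

theorem ActsVia.mul (hB : ∀ γ δ, B (γ * δ) = B γ + galTwist (f γ) (B δ)) {g h : K ≃ₐ[k] K}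
    {γ δ : Γ} (hg : ActsVia f B x g γ) (hh : ActsVia f B x h δ) :
    ActsVia f B x (g * h) (γ * δ) := by
  refine ⟨?_, fun d => ?_⟩
  · rw [map_mul, hg.1, hh.1]
    exact (map_mul (AlgEquiv.restrictNormalHom (F := k) (K₁ := K) L) g h).symm
  · have h1 : ∀ l, g (algebraMap L K l) = algebraMap L K (f γ l) := by
      intro l
      rw [hg.1, AlgEquiv.restrictNormal_commutes]
    rw [AlgEquiv.mul_apply, hh.2, map_add, hg.2, h1, hB, map_mul, mul_smul]
    simp [add_assoc]

theorem ActsVia.unique {j : f.ker → (D →+ L)} (hj : Function.Injective j)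
    (hmul : ∀ a b, j (a * b) = j a + j b)
    (hB : ∀ γ δ, B (γ * δ) = B γ + galTwist (f γ) (B δ)) (hBj : ∀ a : f.ker, B a = j a)
    {g : K ≃ₐ[k] K} {γ δ : Γ} (hγ : ActsVia f B x g γ) (hδ : ActsVia f B x g δ) : γ = δ := by
  have hf : f γ = f δ := hγ.1.trans hδ.1.symm
  have hBB : B γ = B δ := by
    ext d
    have h := (hγ.2 ((f γ)⁻¹ • d)).symm.trans (hδ.2 ((f γ)⁻¹ • d))
    rw [← hf, smul_inv_smul] at h
    exact (algebraMap L K).injective (add_left_cancel h)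
  have hj1 : j 1 = 0 := by
    have := hmul 1 1
    rwa [one_mul, left_eq_add] at this
  let a : f.ker := ⟨γ * δ⁻¹, by simp [MonoidHom.mem_ker, hf]⟩
  have ha : j a = 0 := by
    have h2 := hB (γ * δ⁻¹) δ
    have h3 : galTwist (1 : L ≃ₐ[k] L) (B δ) = B δ := by ext; simp
    rw [inv_mul_cancel_right, hBB, a.2, h3, right_eq_add] at h2
    rw [← hBj]
    exact h2
  have := congrArg Subtype.val (hj (ha.trans hj1.symm))
  exact mul_inv_eq_one.1 this

theorem ActsVia.exists (p : ℕ) [Fact p.Prime] [CharP L p] [CharP K p]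
    (hf : Function.Surjective f)
    {j : f.ker → (D →+ L)} (hj : ∀ y : D →+ L, (∀ d, y d ^ p = y d) → ∃ a, j a = y)
    (hB : ∀ γ δ, B (γ * δ) = B γ + galTwist (f γ) (B δ)) (hBj : ∀ a : f.ker, B a = j a)
    {a : D →+ L} (ha : ∀ γ, galTwist (f γ) a - a = frobHom p (B γ) - B γ)
    (hx : ∀ d, x d ^ p - x d = algebraMap L K (a d)) (g : K ≃ₐ[k] K) :
    ∃ γ, ActsVia f B x g γ := by
  obtain ⟨γ, hγ⟩ := hf (g.restrictNormal L)
  have hgl : ∀ l, g (algebraMap L K l) = algebraMap L K (f γ l) := by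
    intro l
    rw [hγ, AlgEquiv.restrictNormal_commutes]
  let z : D →+ K :=
    { toFun := fun d => g (x ((f γ)⁻¹ • d)) - x d - algebraMap L K (B γ d)
      map_zero' := by simp
      map_add' := fun d e => by simp only [smul_add, map_add]; ring }
  have hz : ∀ d, z d ^ p = z d := by
    intro d
    have h1 : g (x ((f γ)⁻¹ • d)) ^ p - g (x ((f γ)⁻¹ • d)) =
        algebraMap L K (f γ (a ((f γ)⁻¹ • d))) := by
      rw [← map_pow, ← map_sub, hx, hgl]
    have h2 := congrArg (algebraMap L K) (DFunLike.congr_fun (ha γ) d)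
    simp only [AddMonoidHom.sub_apply, galTwist_apply, frobHom_apply, map_sub, map_pow] at h2
    change (g (x ((f γ)⁻¹ • d)) - x d - algebraMap L K (B γ d)) ^ p =
      g (x ((f γ)⁻¹ • d)) - x d - algebraMap L K (B γ d)
    rw [sub_pow_char, sub_pow_char]
    linear_combination h1 - hx d + h2
  choose i hi using fun d => exists_castHom_eq_of_pow_char_eq p (hz d)
  have hcast : ∀ m : ZMod p, algebraMap L K (ZMod.castHom (dvd_refl p) L m) =
      ZMod.castHom (dvd_refl p) K m := by
    intro m
    rw [← RingHom.comp_apply]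
    exact RingHom.congr_fun (Subsingleton.elim _ _) m
  let y : D →+ L :=
    { toFun := fun d => ZMod.castHom (dvd_refl p) L (i d)
      map_zero' := (algebraMap L K).injective (by rw [hcast, hi, map_zero, map_zero])
      map_add' := fun d e => (algebraMap L K).injective (by
        rw [map_add, hcast, hcast, hcast, hi, hi, hi, map_add]) }
  obtain ⟨n, hn⟩ := hj y fun d => by
    change ZMod.castHom (dvd_refl p) L (i d) ^ p = _
    rw [← map_pow, ZMod.pow_card]
    rfl
  have hn1 : f n = 1 := n.2
  refine ⟨n * γ, by rw [map_mul, hn1, one_mul, hγ], fun d => ?_⟩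
  have h3 : galTwist (1 : L ≃ₐ[k] L) (B γ) = B γ := by ext; simp
  rw [hB, map_mul, hn1, one_mul, h3, hBj, hn]
  have h4 : algebraMap L K (y (f γ • d)) = g (x d) - x (f γ • d) - algebraMap L K (B γ (f γ • d)) := by
    change algebraMap L K (ZMod.castHom (dvd_refl p) L (i (f γ • d))) = _
    rw [hcast, hi]
    change g (x ((f γ)⁻¹ • f γ • d)) - _ - _ = _
    rw [inv_smul_smul]
  rw [AddMonoidHom.add_apply, map_add, h4]
  ring

end Solution

section Decomposition

theorem IsNonarchimedean.apply_pow_sub_self_lt_one {F : Type*} [Field F] {w : AbsoluteValue F ℝ}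
    (hw : IsNonarchimedean w) {p : ℕ} (hp : p ≠ 0) {z : F} (hz : w z < 1) : w (z ^ p - z) < 1 :=
  hw.apply_sub_lt (by rw [map_pow]; exact pow_lt_one₀ (w.nonneg z) hz hp) hz

/-- The decomposition group of an absolute value. -/
def AbsoluteValue.decompositionGroup (k : Type*) {K : Type*} [Field k] [Field K] [Algebra k K]
    (w : AbsoluteValue K ℝ) : Subgroup (K ≃ₐ[k] K) where
  carrier := {g | ∀ y, w (g y) = w y}
  mul_mem' := fun {g h} hg hh y => (hg _).trans (hh y)
  one_mem' := fun _ => rfl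
  inv_mem' := fun {g} hg y => by
    rw [← hg (g⁻¹ y)]
    exact congrArg w (g.apply_symm_apply y)

variable {k L K : Type*} [Field k] [Field L] [Field K] [Algebra k L] [Algebra L K]
  [FiniteDimensional L K] [IsGalois L K]

/-- If the decomposition group over `L` were trivial, the Artin-Schreier equation would be
approximately solvable over `L`. -/
theorem exists_orbitSup_lt_one_of_decomposition_trivial {D : Type*} [AddCommGroup D] [Finite D]
    [FiniteDimensional k L] (p : ℕ) [Fact p.Prime] [CharP L p] [CharP K p]
    {v : AbsoluteValue k ℝ} (hv : v.IsNontrivial) (w : AbsoluteValue K ℝ) {w₁ : AbsoluteValue L ℝ}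
    (hw : ∀ y, w (algebraMap L K y) = w₁ y) (hw₁ : ∀ y, w₁ (algebraMap k L y) = v y)
    (huniq : ∃! w₁ : AbsoluteValue L ℝ, ∀ y, w₁ (algebraMap k L y) = v y)
    (hdec : ∀ τ : K ≃ₐ[L] K, (∀ y, w (τ y) = w y) → τ = 1)
    {a : D →+ L} {x : D →+ K} (hx : ∀ d, x d ^ p - x d = algebraMap L K (a d)) :
    ∃ y : D →+ L, orbitSup k w₁ (a - (frobHom p y - y)) < 1 := by
  have hna := AbsoluteValue.isNonarchimedean_of_charP p w
  have hnt : w₁.IsNontrivial := by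
    obtain ⟨y, hy, hy1⟩ := hv
    exact ⟨algebraMap k L y, by simpa using hy, by rwa [hw₁]⟩
  obtain ⟨η, hη⟩ := AbsoluteValue.exists_trace_sub_lt hnt hna hw hdec x
  let y : D →+ L :=
    ((Algebra.trace L K).toAddMonoidHom.comp (AddMonoidHom.mulLeft η)).comp x
  refine ⟨y, orbitSup_lt_iff.2 fun σ d => ?_⟩
  have hσ : w₁.comap (σ : L →+* L) = w₁ := huniq.unique
    (fun y => (congrArg w₁ (σ.commutes y)).trans (hw₁ y)) hw₁
  refine (DFunLike.congr_fun hσ _).trans_lt ?_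
  rw [← hw]
  have h1 : algebraMap L K ((a - (frobHom p y - y)) d) =
      (x d - algebraMap L K (y d)) ^ p - (x d - algebraMap L K (y d)) := by
    simp only [AddMonoidHom.sub_apply, frobHom_apply, map_sub, map_pow, sub_pow_char, ← hx]
    ring
  rw [h1]
  refine hna.apply_pow_sub_self_lt_one (Fact.out : p.Prime).ne_zero ?_
  rw [AbsoluteValue.map_sub]
  exact hη d

variable [Algebra k K] [IsScalarTower k L K] [Normal k L] [Normal k K]

/-- The decomposition group surjects onto the Galois group of a subextension to which the absolute
value extends uniquely. -/
theorem AbsoluteValue.exists_mem_decompositionGroup_restrictNormal_eq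
    {v : AbsoluteValue k ℝ} (hv : v.IsNontrivial) (w : AbsoluteValue K ℝ)
    (hna : ∀ w : AbsoluteValue K ℝ, IsNonarchimedean w)
    (hw : ∀ y, w (algebraMap k K y) = v y)
    (huniq : ∃! w₁ : AbsoluteValue L ℝ, ∀ y, w₁ (algebraMap k L y) = v y) (σ : L ≃ₐ[k] L) :
    ∃ g ∈ w.decompositionGroup k, g.restrictNormal L = σ := by
  obtain ⟨g, hg⟩ := AlgEquiv.restrictNormalHom_surjective (F := k) (K₁ := L) K σ
  replace hg : g.restrictNormal L = σ := hg
  have hext : ∀ g : K ≃ₐ[k] K,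
      ∀ y, (w.comap (g : K →+* K)).comap (algebraMap L K) (algebraMap k L y) = v y := by
    intro g y
    simp only [AbsoluteValue.comap_apply, ← IsScalarTower.algebraMap_apply]
    exact (congrArg w (g.commutes y)).trans (hw y)
  have heq := huniq.unique (hext g) (hext 1)
  let w₁ : AbsoluteValue L ℝ := w.comap (algebraMap L K)
  have hnt : w₁.IsNontrivial := by
    obtain ⟨y, hy, hy1⟩ := hv
    refine ⟨algebraMap k L y, by simpa using hy, ?_⟩
    rwa [AbsoluteValue.comap_apply, ← IsScalarTower.algebraMap_apply, hw]
  obtain ⟨τ, hτ⟩ := AbsoluteValue.exists_comap_eq hnt (hna (w.comap (g : K →+* K)))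
    (w := w) (fun _ => rfl) (fun y => DFunLike.congr_fun heq y)
  refine ⟨g * (τ.restrictScalars k)⁻¹, fun y => ?_, ?_⟩
  · have := hτ (τ⁻¹ y)
    exact this.trans (congrArg w (τ.apply_symm_apply y))
  · have h1 : (τ.restrictScalars k).restrictNormal L = 1 := by
      ext l
      apply (algebraMap L K).injective
      rw [AlgEquiv.restrictNormal_commutes]
      exact τ.commutes l
    have h2 : (g * (τ.restrictScalars k)⁻¹).restrictNormal L =
        g.restrictNormal L * ((τ.restrictScalars k).restrictNormal L)⁻¹ := by
      have := map_mul (AlgEquiv.restrictNormalHom (F := k) (K₁ := K) L) g (τ.restrictScalars k)⁻¹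
      rw [map_inv] at this
      exact this
    rw [h2, h1, hg, inv_one, mul_one]

end Decomposition

section ArtinSchreierExtension

universe u

open Polynomial

theorem degree_X_add_C_lt {F : Type*} [Field F] {p : ℕ} (hp : 1 < p) (c : F) :
    (X + C c : F[X]).degree < p := by
  rw [degree_X_add_C]
  exact_mod_cast hp

theorem monic_X_pow_sub_X_sub_C {F : Type*} [Field F] {p : ℕ} (hp : 1 < p) (c : F) :
    (X ^ p - X - C c : F[X]).Monic := by
  rw [sub_sub]
  exact monic_X_pow_sub (degree_X_add_C_lt hp c)

theorem separable_X_pow_char_sub_X_sub_C (p : ℕ) {F : Type*} [Field F] [CharP F p] (c : F) :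
    (X ^ p - X - C c : F[X]).Separable := by
  rw [separable_def]
  have : derivative (X ^ p - X - C c : F[X]) = -1 := by simp [derivative_X_pow]
  rw [this]
  exact isCoprime_one_right.neg_right

/-- The Artin-Schreier equation with values in additive maps is solvable over an algebraically
closed field. -/
theorem exists_pow_char_sub_self_eq (p : ℕ) [Fact p.Prime] {E D : Type*} [Field E] [IsAlgClosed E]
    [CharP E p] [AddCommGroup D] [Module (ZMod p) D] (a : D →+ E) :
    ∃ x : D →+ E, ∀ d, x d ^ p - x d = a d := by
  let : Algebra (ZMod p) E := ZMod.algebra E p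
  let P : E →+ E := (frobenius E p : E →+ E) - AddMonoidHom.id E
  have hP : Function.Surjective P := by
    intro c
    obtain ⟨z, hz⟩ := IsAlgClosed.exists_root (X ^ p - X - C c : E[X]) (by
      have hp := (Fact.out : p.Prime).one_lt
      rw [sub_sub, degree_sub_eq_left_of_degree_lt (by
        rw [degree_X_pow]
        exact degree_X_add_C_lt hp c), degree_X_pow]
      exact_mod_cast (zero_lt_one.trans hp).ne')
    refine ⟨z, ?_⟩
    change z ^ p - z = c
    simpa [sub_eq_zero, IsRoot] using hz
  obtain ⟨h, hh⟩ := Module.projective_lifting_property (P.toZModLinearMap p)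
    (a.toZModLinearMap p) hP
  exact ⟨h.toAddMonoidHom, fun d => LinearMap.congr_fun hh d⟩

theorem exists_artinSchreier_extension (p : ℕ) [Fact p.Prime] {k : Type*} {L : Type u} {D : Type*}
    [Field k] [Field L] [CharP L p] [Algebra k L] [FiniteDimensional k L] [IsGalois k L]
    [AddCommGroup D] [Finite D] [Module (ZMod p) D] [DistribMulAction (L ≃ₐ[k] L) D]
    (a : D →+ L) (ha : ∀ σ : L ≃ₐ[k] L, ∃ b : D →+ L, galTwist σ a - a = frobHom p b - b) :
    ∃ (K : Type u) (_ : Field K) (_ : Algebra k K) (_ : Algebra L K) (_ : IsScalarTower k L K)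
      (_ : FiniteDimensional k K) (_ : IsGalois k K) (x : D →+ K),
      (∀ d, x d ^ p - x d = algebraMap L K (a d)) ∧
      ∀ g : K ≃ₐ[k] K, (∀ l, g (algebraMap L K l) = algebraMap L K l) → (∀ d, g (x d) = x d) →
        g = 1 := by
  let Ω := AlgebraicClosure L
  have hΩ : CharP Ω p := charP_of_injective_algebraMap (algebraMap L Ω).injective p
  have : Algebra.IsAlgebraic k Ω := Algebra.IsAlgebraic.trans k L Ω
  have : IsAlgClosure k Ω := ⟨inferInstance, inferInstance⟩
  obtain ⟨x, hx⟩ := exists_pow_char_sub_self_eq p ((algebraMap L Ω : L →+ Ω).comp a)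
  replace hx : ∀ d, x d ^ p - x d = algebraMap L Ω (a d) := hx
  let K : IntermediateField L Ω := IntermediateField.adjoin L (Set.range x)
  have hxK : ∀ d, x d ∈ K := fun d => IntermediateField.subset_adjoin _ _ ⟨d, rfl⟩
  have hroot : ∀ d, Polynomial.aeval (x d) (X ^ p - X - C (a d) : L[X]) = 0 := by
    intro d
    simp [hx d]
  have hmonic := fun d => monic_X_pow_sub_X_sub_C (Fact.out : p.Prime).one_lt (a d)
  have hfd : FiniteDimensional L K := IntermediateField.finiteDimensional_adjoin (by
    rintro _ ⟨d, rfl⟩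
    exact ⟨_, hmonic d, by simpa using hroot d⟩)
  have hsep : Algebra.IsSeparable L K := by
    rw [IntermediateField.isSeparable_adjoin_iff_isSeparable]
    rintro _ ⟨d, rfl⟩
    exact (separable_X_pow_char_sub_X_sub_C p (a d)).of_dvd (minpoly.dvd _ _ (hroot d))
  have hnormal : Normal k K := by
    suffices h : Normal k (K.restrictScalars k) from h
    rw [IntermediateField.normal_iff_forall_map_le']
    intro σ
    have hl : ∀ l : L, algebraMap L Ω l ∈ K := fun l => K.algebraMap_mem l
    let g := σ.restrictNormal L
    have hg : ∀ l, σ (algebraMap L Ω l) = algebraMap L Ω (g l) := fun l =>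
      (AlgEquiv.restrictNormal_commutes σ L l).symm
    obtain ⟨b, hb⟩ := ha g
    have hσx : ∀ d, σ (x d) ∈ K := by
      intro d
      have h1 : σ (x d) ^ p - σ (x d) = algebraMap L Ω (g (a d)) := by
        rw [← map_pow, ← map_sub, hx, hg]
      have h2 := congrArg (algebraMap L Ω) (DFunLike.congr_fun hb (g • d))
      simp only [AddMonoidHom.sub_apply, galTwist_apply, frobHom_apply, map_sub, map_pow,
        inv_smul_smul] at h2
      have h3 : (σ (x d) - x (g • d) - algebraMap L Ω (b (g • d))) ^ p =
          σ (x d) - x (g • d) - algebraMap L Ω (b (g • d)) := by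
        rw [sub_pow_char, sub_pow_char]
        linear_combination h1 - hx (g • d) + h2
      obtain ⟨i, hi⟩ := exists_castHom_eq_of_pow_char_eq p h3
      have h4 : ZMod.castHom (dvd_refl p) Ω i = algebraMap L Ω (ZMod.castHom (dvd_refl p) L i) := by
        rw [← RingHom.comp_apply]
        exact RingHom.congr_fun (Subsingleton.elim _ _) i
      have h5 : σ (x d) = algebraMap L Ω (ZMod.castHom (dvd_refl p) L i) + x (g • d) +
          algebraMap L Ω (b (g • d)) := by
        rw [← h4, hi]
        ring
      rw [h5]
      exact K.add_mem (K.add_mem (hl _) (hxK _)) (hl _)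
    have hle : K.toSubfield ≤ K.toSubfield.comap (σ : Ω →+* Ω) := by
      refine Subfield.closure_le.2 (Set.union_subset ?_ ?_)
      · rintro _ ⟨l, rfl⟩
        change σ (algebraMap L Ω l) ∈ K
        rw [hg]
        exact hl _
      · rintro _ ⟨d, rfl⟩
        exact hσx d
    rintro _ ⟨y, hy, rfl⟩
    exact hle hy
  have hfdk : FiniteDimensional k K := FiniteDimensional.trans k L K
  have hsepk : Algebra.IsSeparable k K := Algebra.IsSeparable.trans k L K
  refine ⟨K, inferInstance, inferInstance, inferInstance, inferInstance, hfdk, ⟨⟩,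
    { toFun := fun d => ⟨x d, hxK d⟩, map_zero' := Subtype.ext (map_zero x),
      map_add' := fun d e => Subtype.ext (map_add x d e) },
    fun d => Subtype.ext (hx d), fun g hg hgx => ?_⟩
  let g' : K →ₐ[L] K := { (g : K →+* K) with commutes' := hg }
  have hg' : g' = AlgHom.id L K := IntermediateField.adjoin_algHom_ext L (by
    rintro _ ⟨d, rfl⟩
    exact hgx d)
  ext y
  exact congrArg Subtype.val (DFunLike.congr_fun hg' y)

end ArtinSchreierExtension

section Duality

universe u

/-- An elementary abelian kernel is the dual of a finite module on which the quotient acts. -/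
theorem exists_equivariant_duality (p : ℕ) [Fact p.Prime] {Γ : Type u} {G : Type*} [Group Γ]
    [Finite Γ] [Group G] {f : Γ →* G} (hf : Function.Surjective f)
    (hcomm : ∀ a ∈ f.ker, ∀ b ∈ f.ker, a * b = b * a) (hexp : ∀ a ∈ f.ker, a ^ p = 1) :
    ∃ (D : Type u) (_ : AddCommGroup D) (_ : Finite D) (_ : Module (ZMod p) D)
      (_ : DistribMulAction G D) (ev : f.ker → (D →+ ZMod p)), Function.Bijective ev ∧
      (∀ a b, ev (a * b) = ev a + ev b) ∧
      ∀ γ a d, ev (MulAut.conjNormal γ a) d = ev a ((f γ)⁻¹ • d) := by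
  let : CommGroup f.ker :=
    { (inferInstance : Group f.ker) with
      mul_comm := fun a b => Subtype.ext (hcomm a a.2 b b.2) }
  let V := Additive f.ker
  let : Module (ZMod p) V := AddCommGroup.zmodModule (n := p) fun a =>
    congrArg Additive.ofMul (Subtype.ext (hexp _ a.toMul.2) : a.toMul ^ p = 1)
  obtain ⟨φ, hφ⟩ : ∃ φ : G →* MulAut f.ker, ∀ γ, φ (f γ) = MulAut.conjNormal γ := by
    refine ⟨f.liftOfSurjective hf ⟨MulAut.conjNormal, fun a ha => ?_⟩, fun γ =>
      f.liftOfRightInverse_comp_apply _ _ _ γ⟩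
    ext b
    simp [hcomm a ha b b.2]
  let : DistribMulAction G (V →+ ZMod p) :=
    { smul := fun σ d => d.comp (MonoidHom.toAdditive (φ σ⁻¹ : f.ker →* f.ker))
      one_smul := fun d => AddMonoidHom.ext fun (a : V) => by
        change d (Additive.ofMul (φ 1⁻¹ a.toMul)) = d a
        simp
      mul_smul := fun σ τ d => AddMonoidHom.ext fun (a : V) => by
        change d (Additive.ofMul (φ (σ * τ)⁻¹ a.toMul)) =
          d (Additive.ofMul (φ τ⁻¹ (φ σ⁻¹ a.toMul)))
        simp
      smul_zero := fun _ => rfl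
      smul_add := fun _ _ _ => rfl }
  have hsmul : ∀ (σ : G) (d : V →+ ZMod p) (a : f.ker),
    (σ • d) (Additive.ofMul a) = d (Additive.ofMul (φ σ⁻¹ a)) := fun _ _ _ => rfl
  have : Finite V := inferInstanceAs (Finite f.ker)
  have : Finite (V →+ ZMod p) := DFunLike.finite _
  refine ⟨V →+ ZMod p, inferInstance, inferInstance, inferInstance, inferInstance,
    fun a => AddMonoidHom.eval (Additive.ofMul a), ⟨fun a b hab => ?_, fun y => ?_⟩,
    fun a b => ?_, fun γ a d => ?_⟩
  · apply Additive.ofMul.injective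
    apply (Module.evalEquiv (ZMod p) V).injective
    ext d
    exact DFunLike.congr_fun hab d.toAddMonoidHom
  · let Y : Module.Dual (ZMod p) (Module.Dual (ZMod p) V) :=
      (y.comp (AddMonoidHom.toZModLinearMapEquiv p).symm.toAddMonoidHom).toZModLinearMap p
    refine ⟨((Module.evalEquiv (ZMod p) V).symm Y).toMul, ?_⟩
    ext d
    have := LinearMap.congr_fun ((Module.evalEquiv (ZMod p) V).apply_symm_apply Y)
      (d.toZModLinearMap p)
    exact this
  · ext d
    exact map_add d _ _
  · change d (Additive.ofMul _) = _
    rw [← hφ]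
    change _ = ((f γ)⁻¹ • d) (Additive.ofMul a)
    rw [hsmul, inv_inv]

theorem exists_equivariant_embedding (p : ℕ) [Fact p.Prime] {k L : Type*} {Γ : Type u} [Field k]
    [Field L] [Algebra k L] [CharP L p] [Group Γ]
    [Finite Γ] {f : Γ →* (L ≃ₐ[k] L)} (hf : Function.Surjective f)
    (hcomm : ∀ a ∈ f.ker, ∀ b ∈ f.ker, a * b = b * a) (hexp : ∀ a ∈ f.ker, a ^ p = 1) :
    ∃ (D : Type u) (_ : AddCommGroup D) (_ : Finite D) (_ : Module (ZMod p) D)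
      (_ : DistribMulAction (L ≃ₐ[k] L) D) (j : f.ker → (D →+ L)), Function.Injective j ∧
      (∀ y : D →+ L, (∀ d, y d ^ p = y d) → ∃ a, j a = y) ∧
      (∀ a, frobHom p (j a) - j a = 0) ∧
      (∀ a b, j (a * b) = j a + j b) ∧
      ∀ γ a, j (MulAut.conjNormal γ a) = galTwist (f γ) (j a) := by
  obtain ⟨D, _, hfin, _, _, ev, hev, hmul, hconj⟩ := exists_equivariant_duality p hf hcomm hexp
  let c := ZMod.castHom (dvd_refl p) L
  refine ⟨D, _, hfin, inferInstance, inferInstance, fun a => (c : ZMod p →+ L).comp (ev a),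
    fun a b hab => hev.1 ?_, fun y hy => ?_, fun a => ?_, fun a b => ?_, fun γ a => ?_⟩
  · ext d
    exact c.injective (DFunLike.congr_fun hab d)
  · choose i hi using fun d => exists_castHom_eq_of_pow_char_eq p (hy d)
    let z : D →+ ZMod p :=
      { toFun := i
        map_zero' := c.injective (by rw [hi, map_zero, map_zero])
        map_add' := fun d e => c.injective (by rw [map_add, hi, hi, hi, map_add]) }
    obtain ⟨a, ha⟩ := hev.2 z
    refine ⟨a, ?_⟩
    ext d
    change c (ev a d) = y d
    rw [← hi, ha]
    rfl
  · ext d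
    change c (ev a d) ^ p - c (ev a d) = 0
    rw [← map_pow, ZMod.pow_card, sub_self]
  · ext d
    change c (ev (a * b) d) = c (ev a d) + c (ev b d)
    rw [hmul, ← map_add]
    rfl
  · ext d
    change c (ev _ d) = f γ (c (ev a _))
    rw [hconj]
    exact (RingHom.congr_fun (Subsingleton.elim (((f γ : L ≃ₐ[k] L) : L →+* L).comp c) c) _).symm

end Duality

section Step

theorem AbsoluteValue.isNontrivial_of_exists_lt_one {F : Type*} [Field F] {v : AbsoluteValue F ℝ}
    (h : ∃ c : ℝ, 0 < c ∧ c < 1 ∧ (∃ t, v t = c) ∧ ∀ x : F, x ≠ 0 → ∃ n : ℤ, v x = c ^ n) :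
    v.IsNontrivial := by
  obtain ⟨c, hc, hc1, ⟨t, rfl⟩, -⟩ := h
  exact ⟨t, v.pos_iff.1 hc, hc1.ne⟩

section Correspondence

variable {k L K D Γ : Type*} [Field k] [Field L] [Field K] [Algebra k L] [Algebra k K]
  [Algebra L K] [IsScalarTower k L K] [Normal k L]
  [AddCommGroup D] [DistribMulAction (L ≃ₐ[k] L) D] [Group Γ]

/-- The Galois group of an Artin-Schreier extension embeds in the extension of Galois groups that
the equation describes. -/
theorem exists_injective_monoidHom_restrictNormal (p : ℕ) [Fact p.Prime] [CharP L p] [CharP K p]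
    {f : Γ →* (L ≃ₐ[k] L)} (hf : Function.Surjective f)
    {j : f.ker → (D →+ L)} (hj : Function.Injective j)
    (hj' : ∀ y : D →+ L, (∀ d, y d ^ p = y d) → ∃ a, j a = y)
    (hmul : ∀ a b, j (a * b) = j a + j b) {B : Γ → (D →+ L)}
    (hB : ∀ γ δ, B (γ * δ) = B γ + galTwist (f γ) (B δ)) (hBj : ∀ a : f.ker, B a = j a)
    {a : D →+ L} (ha : ∀ γ, galTwist (f γ) a - a = frobHom p (B γ) - B γ) {x : D →+ K}
    (hx : ∀ d, x d ^ p - x d = algebraMap L K (a d))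
    (hgen : ∀ g : K ≃ₐ[k] K, (∀ l, g (algebraMap L K l) = algebraMap L K l) →
      (∀ d, g (x d) = x d) → g = 1) :
    ∃ ψ : (K ≃ₐ[k] K) →* Γ, Function.Injective ψ ∧ ∀ g, f (ψ g) = g.restrictNormal L := by
  choose ψ hψ using ActsVia.exists (K := K) p hf hj' hB hBj ha hx
  let Ψ : (K ≃ₐ[k] K) →* Γ := MonoidHom.mk' ψ fun g h =>
    (hψ (g * h)).unique hj hmul hB hBj ((hψ g).mul hB (hψ h))
  refine ⟨Ψ, (injective_iff_map_eq_one Ψ).2 fun g hg => ?_, fun g => (hψ g).1⟩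
  replace hg : ψ g = 1 := hg
  obtain ⟨h1, h2⟩ := hψ g
  have hB1 : B 1 = 0 := by
    have := hB 1 1
    rw [one_mul, left_eq_add] at this
    ext d
    simpa using DFunLike.congr_fun this d
  rw [hg, map_one] at h1 h2
  refine hgen g (fun l => ?_) fun d => ?_
  · rw [← AlgEquiv.restrictNormal_commutes, ← h1, AlgEquiv.one_apply]
  · rw [h2, hB1]
    simp

/-- Subgroups of the Galois group of an Artin-Schreier extension which surject onto the Galois
group of the base and have nontrivial intersection with the kernel are everything. -/
theorem map_eq_top_of_surjective_restrictNormal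
    {f : Γ →* (L ≃ₐ[k] L)}
    (hcomm : ∀ a ∈ f.ker, ∀ b ∈ f.ker, a * b = b * a)
    (hmin : ∀ H : Subgroup Γ, H.Normal → H ≤ f.ker → H = ⊥ ∨ H = f.ker)
    {ψ : (K ≃ₐ[k] K) →* Γ} (hψ : Function.Injective ψ) (hψf : ∀ g, f (ψ g) = g.restrictNormal L)
    {H : Subgroup (K ≃ₐ[k] K)} (hH : ∀ σ : L ≃ₐ[k] L, ∃ h ∈ H, h.restrictNormal L = σ)
    (hnt : ¬ ∀ τ : K ≃ₐ[L] K, τ.restrictScalars k ∈ H → τ = 1) : H.map ψ = ⊤ := by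
  refine (Subgroup.inf_ker_eq_bot_or_eq_top hcomm hmin fun γ => ?_).resolve_left fun hbot => ?_
  · obtain ⟨h, hh, hσ⟩ := hH (f γ)
    exact ⟨ψ h, Subgroup.mem_map_of_mem ψ hh, by rw [hψf, hσ]⟩
  · refine hnt fun τ hτ => ?_
    have hker : ψ (τ.restrictScalars k) ∈ f.ker := by
      rw [MonoidHom.mem_ker, hψf]
      ext l
      apply (algebraMap L K).injective
      rw [AlgEquiv.restrictNormal_commutes]
      exact τ.commutes l
    have h1 : ψ (τ.restrictScalars k) = 1 := by
      rw [← Subgroup.mem_bot, ← hbot]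
      exact ⟨Subgroup.mem_map_of_mem ψ hτ, hker⟩
    have h2 := hψ (h1.trans (map_one ψ).symm)
    ext y
    exact DFunLike.congr_fun h2 y

end Correspondence

universe u

/-- Solution with local conditions of an embedding problem with minimal elementary abelian
kernel. -/
theorem exists_solution_of_minimal_ker (p : ℕ) [Fact p.Prime] {k : Type*} {L : Type u} {Γ : Type*}
    [Field k] [CharP k p] [Field L] [Algebra k L] [FiniteDimensional k L] [IsGalois k L] [Group Γ]
    [Finite Γ] {f : Γ →* (L ≃ₐ[k] L)} (hf : Function.Surjective f)
    (hcomm : ∀ a ∈ f.ker, ∀ b ∈ f.ker, a * b = b * a) (hexp : ∀ a ∈ f.ker, a ^ p = 1)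
    (hmin : ∀ H : Subgroup Γ, H.Normal → H ≤ f.ker → H = ⊥ ∨ H = f.ker) (hne : f.ker ≠ ⊥)
    {ι : Type*} [Finite ι] [Nonempty ι] {v : ι → AbsoluteValue k ℝ}
    (hdisc : ∀ i, ∃ c : ℝ, 0 < c ∧ c < 1 ∧ (∃ t, v i t = c) ∧
      ∀ x : k, x ≠ 0 → ∃ n : ℤ, v i x = c ^ n)
    (hv : Pairwise fun i j => ¬ (v i).IsEquiv (v j)) {S : Set ι}
    (hS : ∀ i ∈ S, ∃! w : AbsoluteValue L ℝ, ∀ x, w (algebraMap k L x) = v i x) :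
    ∃ (K : Type u) (_ : Field K) (_ : Algebra k K) (_ : Algebra L K) (_ : IsScalarTower k L K)
      (_ : FiniteDimensional k K) (_ : IsGalois k K) (ψ : (K ≃ₐ[k] K) ≃* Γ),
      (∀ σ : K ≃ₐ[k] K, f (ψ σ) = σ.restrictNormal L) ∧
      ∀ i ∈ S, ∃! w : AbsoluteValue K ℝ, ∀ x, w (algebraMap k K x) = v i x := by
  have hLp : CharP L p := charP_of_injective_algebraMap (algebraMap k L).injective p
  have hnt := fun i => AbsoluteValue.isNontrivial_of_exists_lt_one (hdisc i)
  obtain ⟨D, _, hfin, _, _, j, hj, hj', hjP, hmul, hconj⟩ :=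
    exists_equivariant_embedding p hf hcomm hexp
  obtain ⟨B, hB, hBj⟩ := exists_crossed_of_ker hf j hmul hconj
  obtain ⟨a₀, ha₀⟩ := exists_galTwist_sub_eq_of_crossed hf (fun γ => frobHom p (B γ) - B γ)
    (fun γ δ => by
      rw [hB]
      ext d
      simp only [AddMonoidHom.sub_apply, AddMonoidHom.add_apply, frobHom_apply, galTwist_apply,
        add_pow_char, map_sub, map_pow]
      ring)
    (fun γ hγ => by
      have := hjP ⟨γ, hγ⟩
      rwa [← hBj] at this)
  obtain ⟨n, hn⟩ := Subgroup.ne_bot_iff_exists_ne_one.1 hne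
  have hjn : j n ≠ 0 := by
    intro h
    have h1 := hmul n 1
    rw [mul_one, left_eq_add] at h1
    exact hn (hj (h.trans h1.symm))
  obtain ⟨e, he, hinv⟩ := exists_invariant_ne_zero (k := k) hjn
  choose w hw using fun i => (v i).exists_extension (E := L) (hnt i)
    (AbsoluteValue.isNonarchimedean_of_charP p _)
  obtain ⟨u, hu, hbig⟩ := exists_invariant_forall_one_le_add p
    (fun i => AbsoluteValue.isNonarchimedean_of_charP p (w i))
    (fun i => AbsoluteValue.isNonarchimedean_of_charP p (v i)) hw hnt hdisc hv he hinv a₀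
  set a := a₀ + u with ha_def
  have ha : ∀ γ, galTwist (f γ) a - a = frobHom p (B γ) - B γ := by
    intro γ
    rw [← ha₀, ha_def, galTwist_add, hu]
    abel
  obtain ⟨K, _, _, _, _, _, _, x, hx, hgen⟩ := exists_artinSchreier_extension p a fun σ => by
    obtain ⟨γ, rfl⟩ := hf σ
    exact ⟨B γ, ha γ⟩
  have hKp : CharP K p := charP_of_injective_algebraMap (algebraMap k K).injective p
  have : FiniteDimensional L K := FiniteDimensional.right k L K
  have : IsGalois L K := IsGalois.tower_top_of_isGalois k L K
  obtain ⟨ψ, hψ, hψf⟩ :=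
    exists_injective_monoidHom_restrictNormal p hf hj hj' hmul hB hBj ha hx hgen
  have htriv : ¬ ∀ τ : K ≃ₐ[L] K, τ = 1 := by
    intro h
    have hL : ∀ z : K, ∃ l, algebraMap L K l = z := fun z =>
      (IsGalois.mem_range_algebraMap_iff_fixed z).2 fun τ => by rw [h τ]; rfl
    choose y hy using fun d => hL (x d)
    let Y : D →+ L :=
      { toFun := y
        map_zero' := (algebraMap L K).injective (by rw [hy, map_zero, map_zero])
        map_add' := fun d e => (algebraMap L K).injective (by rw [map_add, hy, hy, hy, map_add]) }
    have hY : a - (frobHom p Y - Y) = 0 := by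
      ext d
      apply (algebraMap L K).injective
      change algebraMap L K (a d - (y d ^ p - y d)) = algebraMap L K 0
      rw [map_sub, map_sub, map_pow, hy, hx, sub_self, map_zero]
    obtain ⟨i⟩ := ‹Nonempty ι›
    refine (hbig i Y).not_gt ?_
    rw [hY, orbitSup_lt_iff]
    simp
  have hsurj : Function.Surjective ψ := by
    rw [← MonoidHom.range_eq_top, MonoidHom.range_eq_map]
    refine map_eq_top_of_surjective_restrictNormal hcomm hmin hψ hψf (fun σ => ?_)
      fun h => htriv fun τ => h τ (Subgroup.mem_top _)
    obtain ⟨g, hg⟩ := AlgEquiv.restrictNormalHom_surjective (F := k) (K₁ := L) K σ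
    exact ⟨g, Subgroup.mem_top _, hg⟩
  refine ⟨K, inferInstance, inferInstance, inferInstance, inferInstance, inferInstance,
    inferInstance, MulEquiv.ofBijective ψ ⟨hψ, hsurj⟩, hψf, fun i hi => ?_⟩
  have hKna := fun w : AbsoluteValue K ℝ => AbsoluteValue.isNonarchimedean_of_charP p w
  refine AbsoluteValue.existsUnique_extension (hnt i)
    (AbsoluteValue.isNonarchimedean_of_charP p _) hKna fun W hW => ?_
  have hWL : W.comap (algebraMap L K) = w i := (hS i hi).unique
    (fun z => by rw [AbsoluteValue.comap_apply, ← IsScalarTower.algebraMap_apply, hW]) (hw i)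
  have htop := map_eq_top_of_surjective_restrictNormal hcomm hmin hψ hψf
    (AbsoluteValue.exists_mem_decompositionGroup_restrictNormal_eq (hnt i) W hKna hW (hS i hi))
    (fun h => by
      obtain ⟨y, hy⟩ := exists_orbitSup_lt_one_of_decomposition_trivial p (hnt i) W
        (fun z => DFunLike.congr_fun hWL z) (hw i) (hS i hi) h hx
      exact (hbig i y).not_gt hy)
  intro τ
  obtain ⟨g, hg, hgτ⟩ := (htop.ge (Subgroup.mem_top (ψ τ)) : ψ τ ∈ Subgroup.map ψ _)
  rw [← hψ hgτ]
  exact hg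

end Step

section Induction

/-- A nontrivial normal `p`-subgroup of a finite group contains a minimal normal subgroup, which is
moreover elementary abelian. -/
theorem exists_minimal_normal_le {p : ℕ} [Fact p.Prime] {Γ : Type*} [Group Γ] [Finite Γ]
    {P : Subgroup Γ} [P.Normal] (hP : IsPGroup p P) (hne : P ≠ ⊥) :
    ∃ N : Subgroup Γ, N.Normal ∧ N ≤ P ∧ N ≠ ⊥ ∧ (∀ a ∈ N, ∀ b ∈ N, a * b = b * a) ∧
      (∀ a ∈ N, a ^ p = 1) ∧ ∀ H : Subgroup Γ, H.Normal → H ≤ N → H = ⊥ ∨ H = N := by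
  let Z : Subgroup Γ :=
    { carrier := {a | a ∈ P ∧ (∀ b ∈ P, a * b = b * a) ∧ a ^ p = 1}
      one_mem' := ⟨P.one_mem, fun b _ => by simp, one_pow p⟩
      mul_mem' := by
        rintro a b ⟨ha, ha', hap⟩ ⟨hb, hb', hbp⟩
        refine ⟨P.mul_mem ha hb, fun c hc => ?_, ?_⟩
        · rw [mul_assoc, hb' c hc, ← mul_assoc, ha' c hc, mul_assoc]
        · rw [Commute.mul_pow (ha' b hb), hap, hbp, one_mul]
      inv_mem' := by
        rintro a ⟨ha, ha', hap⟩
        exact ⟨P.inv_mem ha, fun b hb => Commute.inv_left (ha' b hb),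
          by rw [inv_pow, hap, inv_one]⟩ }
  have hZn : Z.Normal := by
    refine ⟨fun a ⟨ha, ha', hap⟩ g => ⟨Subgroup.Normal.conj_mem ‹_› a ha g, fun b hb => ?_, ?_⟩⟩
    · have := ha' (g⁻¹ * b * g) (by simpa using Subgroup.Normal.conj_mem ‹P.Normal› b hb g⁻¹)
      have := congrArg (fun x => g * x * g⁻¹) this
      simpa [mul_assoc] using this
    · rw [conj_pow, hap, mul_one, mul_inv_cancel]
  have hZ : Z ≠ ⊥ := by
    have : Nontrivial P := (Subgroup.nontrivial_iff_ne_bot P).2 hne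
    have := hP.center_nontrivial
    have hc : IsPGroup p (Subgroup.center P) := hP.to_subgroup _
    obtain ⟨n, hn, hn'⟩ := hc.nontrivial_iff_card.1 this
    obtain ⟨z, hz⟩ := exists_prime_orderOf_dvd_card' (G := Subgroup.center P) p
      (hn' ▸ dvd_pow_self p hn.ne')
    have hz1 : z ≠ 1 := by
      rintro rfl
      rw [orderOf_one] at hz
      exact (Fact.out : p.Prime).one_lt.ne hz
    refine Subgroup.ne_bot_iff_exists_ne_one.2 ⟨⟨((z : P) : Γ), (z : P).2, fun b hb => ?_, ?_⟩, ?_⟩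
    · exact congrArg Subtype.val (Subgroup.mem_center_iff.1 z.2 ⟨b, hb⟩).symm
    · have := pow_orderOf_eq_one z
      rw [hz] at this
      exact congrArg (fun x : Subgroup.center P => ((x : P) : Γ)) this
    · intro h
      exact hz1 (Subtype.ext (Subtype.ext (congrArg (fun x : Z => (x : Γ)) h)))
  obtain ⟨N, ⟨hNn, hNZ, hN⟩, hmin⟩ :=
    Set.Finite.exists_minimal (Set.toFinite {N : Subgroup Γ | N.Normal ∧ N ≤ Z ∧ N ≠ ⊥})
      ⟨Z, hZn, le_rfl, hZ⟩
  refine ⟨N, hNn, fun a ha => (hNZ ha).1, hN, fun a ha b hb => (hNZ ha).2.1 b (hNZ hb).1,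
    fun a ha => (hNZ ha).2.2, fun H hH hHN => or_iff_not_imp_left.2 fun hb => ?_⟩
  exact hHN.antisymm (hmin ⟨hH, hHN.trans hNZ, hb⟩ hHN)

theorem AlgEquiv.restrictNormal_restrictNormal {k L E K : Type*} [Field k] [Field L] [Field E]
    [Field K] [Algebra k L] [Algebra k E] [Algebra k K] [Algebra L E] [Algebra L K] [Algebra E K]
    [IsScalarTower k L E] [IsScalarTower k L K] [IsScalarTower k E K] [IsScalarTower L E K]
    [_root_.Normal k L] [_root_.Normal k E] (σ : K ≃ₐ[k] K) :
    (σ.restrictNormal E).restrictNormal L = σ.restrictNormal L := by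
  ext l
  apply (algebraMap L K).injective
  rw [restrictNormal_commutes, IsScalarTower.algebraMap_apply L E K, restrictNormal_commutes,
    restrictNormal_commutes, ← IsScalarTower.algebraMap_apply]

theorem AlgEquiv.restrictNormal_self {k L : Type*} [Field k] [Field L] [Algebra k L]
    [_root_.Normal k L] (σ : L ≃ₐ[k] L) : σ.restrictNormal L = σ := by
  ext l
  exact restrictNormal_commutes σ L l

universe u

/-- Embedding problems with `p`-group kernel in characteristic `p` have proper solutions with
prescribed nonsplit places. -/
theorem exists_solution_of_isPGroup_ker (p : ℕ) [Fact p.Prime] {k : Type*} {L : Type u}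
    {Γ : Type*} [Field k] [CharP k p] [Field L] [Algebra k L] [FiniteDimensional k L]
    [IsGalois k L] [Group Γ] [Finite Γ] {f : Γ →* (L ≃ₐ[k] L)} (hf : Function.Surjective f)
    (hker : IsPGroup p f.ker)
    {ι : Type*} [Finite ι] [Nonempty ι] {v : ι → AbsoluteValue k ℝ}
    (hdisc : ∀ i, ∃ c : ℝ, 0 < c ∧ c < 1 ∧ (∃ t, v i t = c) ∧
      ∀ x : k, x ≠ 0 → ∃ n : ℤ, v i x = c ^ n)
    (hv : Pairwise fun i j => ¬ (v i).IsEquiv (v j)) {S : Set ι}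
    (hS : ∀ i ∈ S, ∃! w : AbsoluteValue L ℝ, ∀ x, w (algebraMap k L x) = v i x) :
    ∃ (K : Type u) (_ : Field K) (_ : Algebra k K) (_ : Algebra L K) (_ : IsScalarTower k L K)
      (_ : FiniteDimensional k K) (_ : IsGalois k K) (ψ : (K ≃ₐ[k] K) ≃* Γ),
      (∀ σ : K ≃ₐ[k] K, f (ψ σ) = σ.restrictNormal L) ∧
      ∀ i ∈ S, ∃! w : AbsoluteValue K ℝ, ∀ x, w (algebraMap k K x) = v i x := by
  induction h : Nat.card Γ using Nat.strong_induction_on generalizing Γ with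
  | _ m ih =>
  subst h
  by_cases hbot : f.ker = ⊥
  · refine ⟨L, inferInstance, inferInstance, Algebra.id L, inferInstance, inferInstance,
      inferInstance,
      (MulEquiv.ofBijective f ⟨(MonoidHom.ker_eq_bot_iff f).1 hbot, hf⟩).symm, fun σ => ?_, hS⟩
    rw [AlgEquiv.restrictNormal_self]
    exact (MulEquiv.ofBijective f ⟨(MonoidHom.ker_eq_bot_iff f).1 hbot, hf⟩).apply_symm_apply σ
  obtain ⟨N, hNn, hNf, hN, hcomm, hexp, hmin⟩ := exists_minimal_normal_le hker hbot
  have hf' : Function.Surjective (QuotientGroup.lift N f hNf) :=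
    QuotientGroup.lift_surjective_of_surjective N f hf hNf
  have hker' : IsPGroup p (QuotientGroup.lift N f hNf).ker := by
    rw [QuotientGroup.ker_lift]
    exact hker.map _
  have hcard : Nat.card (Γ ⧸ N) < Nat.card Γ := by
    rw [Subgroup.card_eq_card_quotient_mul_card_subgroup N]
    exact lt_mul_of_one_lt_right Nat.card_pos (N.one_lt_card_iff_ne_bot.2 hN)
  obtain ⟨E, _, _, _, _, _, _, φ, hφ, hSE⟩ := ih _ hcard hf' hker' rfl
  let g : Γ →* (E ≃ₐ[k] E) := φ.symm.toMonoidHom.comp (QuotientGroup.mk' N)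
  have hg : Function.Surjective g := φ.symm.surjective.comp (QuotientGroup.mk'_surjective N)
  have hgker : g.ker = N := by
    ext γ
    simp [g]
  obtain ⟨K, _, _, _, _, _, _, ψ, hψ, hSK⟩ := exists_solution_of_minimal_ker p hg (by rwa [hgker])
    (by rwa [hgker]) (by rwa [hgker]) (by rwa [hgker]) hdisc hv hSE
  let _ : Algebra L K := ((algebraMap E K).comp (algebraMap L E)).toAlgebra
  have : IsScalarTower L E K := IsScalarTower.of_algebraMap_eq fun _ => rfl
  have : IsScalarTower k L K := IsScalarTower.of_algebraMap_eq fun x => by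
    rw [IsScalarTower.algebraMap_apply k E K, IsScalarTower.algebraMap_apply k L E]
    rfl
  refine ⟨K, inferInstance, inferInstance, inferInstance, inferInstance, inferInstance,
    inferInstance, ψ, fun σ => ?_, hSK⟩
  have h1 : f (ψ σ) = QuotientGroup.lift N f hNf (φ (g (ψ σ))) := by simp [g]
  rw [h1, hφ, hψ, AlgEquiv.restrictNormal_restrictNormal]

end Induction

theorem AbsoluteValue.IsEquiv.isEquivalent {k : Type} [Field k] {v w : AbsoluteValue k ℝ}
    (h : v.IsEquiv w) : v.IsEquivalent w := by
  obtain ⟨r, hr, h⟩ := AbsoluteValue.isEquiv_iff_exists_rpow_eq.1 h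
  exact ⟨r, hr, fun x => (congrFun h x).symm⟩

/-- Let `k` be a field of characteristic `p > 0` admitting infinitely many pairwise
inequivalent discrete valuations.  Let `L/k` be a finite Galois extension,
`f : Γ → Gal(L/k)` a surjection of finite groups with `p`-group kernel, and
`v 1, …, v n` finitely many pairwise inequivalent discrete valuations of `k`, each of
which extends uniquely to `L`.  Then the embedding problem has a proper solution
`K ⊇ L ⊇ k` (with `ψ : Gal(K/k) ≃ Γ` compatible with restriction to `L`) such that
each `v i` also extends uniquely to `K`. -/
theorem pEmbeddingProblem_properly_solvable_with_local_conditions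
    (p : ℕ) [Fact p.Prime] (k : Type) [Field k] [CharP k p]
    (hvals : ∃ v : ℕ → AbsoluteValue k ℝ,
      (∀ n, (v n).IsDiscrete) ∧ ∀ m n, m ≠ n → ¬ (v m).IsEquivalent (v n))
    (L : Type) [Field L] [Algebra k L] [FiniteDimensional k L] [IsGalois k L]
    (Γ : Type) [Group Γ] [Finite Γ]
    (f : Γ →* (L ≃ₐ[k] L)) (hf : Function.Surjective f) (hker : IsPGroup p f.ker)
    (n : ℕ) (v : Fin n → AbsoluteValue k ℝ)
    (hdisc : ∀ i, (v i).IsDiscrete)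
    (hpairwise : ∀ i j, i ≠ j → ¬ (v i).IsEquivalent (v j))
    (hunique : ∀ i, ∃! w : AbsoluteValue L ℝ, ∀ x : k, w (algebraMap k L x) = v i x) :
    ∃ (K : Type) (_ : Field K) (_ : Algebra k K) (_ : Algebra L K)
      (_ : IsScalarTower k L K) (_ : FiniteDimensional k K) (_ : IsGalois k K)
      (ψ : (K ≃ₐ[k] K) ≃* Γ),
      (∀ σ : K ≃ₐ[k] K, f (ψ σ) = AlgEquiv.restrictNormal σ L) ∧
      ∀ i, ∃! w : AbsoluteValue K ℝ, ∀ x : k, w (algebraMap k K x) = v i x := by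
  rcases Nat.eq_zero_or_pos n with rfl | hn
  · obtain ⟨u, hu, -⟩ := hvals
    obtain ⟨K, _, _, _, _, _, _, ψ, hψ, -⟩ := exists_solution_of_isPGroup_ker p hf hker
      (v := fun _ : Unit => u 0) (S := ∅) (fun _ => (hu 0).2)
      (fun i j hij => (hij rfl).elim) (fun _ hi => hi.elim)
    exact ⟨K, inferInstance, inferInstance, inferInstance, inferInstance, inferInstance,
      inferInstance, ψ, hψ, fun i => i.elim0⟩
  · have : Nonempty (Fin n) := ⟨⟨0, hn⟩⟩
    obtain ⟨K, _, _, _, _, _, _, ψ, hψ, hK⟩ := exists_solution_of_isPGroup_ker p hf hker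
      (S := Set.univ) (fun i => (hdisc i).2)
      (fun i j hij h => hpairwise i j hij h.isEquivalent) (fun i _ => hunique i)
    exact ⟨K, inferInstance, inferInstance, inferInstance, inferInstance, inferInstance,
      inferInstance, ψ, hψ, fun i => hK i (Set.mem_univ i)⟩
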